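/- Let r and t be positive integers. Then there exists a polynomial g such that every graph G containing no induced subdivision of the complete bipartite graph K_{r,t} has average degree at most g(ω(G)), where ω(G) is the clique number of G. -/

import Mathlib

open SimpleGraph

/-- `G` contains a copy of `H` as a (not necessarily induced) subgraph. -/
def HasSubgraphCopy {V W : Type} (G : SimpleGraph V) (H : SimpleGraph W) : Prop :=
  ∃ f : H →g G, Function.Injective f

/-- `G` contains an induced copy of `H`. -/
def HasInducedCopy {V W : Type} (G : SimpleGraph V) (H : SimpleGraph W) : Prop :=
  ∃ s : Set V, Nonempty ((G.induce s) ≃g H)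

/-- The graph obtained from `G` by subdividing the edge `ab` once (`none` is the new vertex). -/
def edgeSubdiv {V : Type} (G : SimpleGraph V) (a b : V) : SimpleGraph (Option V) :=
  SimpleGraph.fromRel (fun x y =>
    (∃ x' y' : V, x = some x' ∧ y = some y' ∧ G.Adj x' y' ∧
      ¬((x' = a ∧ y' = b) ∨ (x' = b ∧ y' = a))) ∨
    (x = none ∧ (y = some a ∨ y = some b)))

/-- `IsSubdivision H S` : `S` is obtained from `H` by a finite sequence of single edge
subdivisions (edges of `H` get replaced by possibly longer paths). -/
inductive IsSubdivision : {V : Type} → SimpleGraph V → {W : Type} → SimpleGraph W → Prop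
  | refl {V : Type} (G : SimpleGraph V) : IsSubdivision G G
  | step {V W : Type} (G : SimpleGraph V) (H : SimpleGraph W) (a b : W) :
      IsSubdivision G H → H.Adj a b → IsSubdivision G (edgeSubdiv H a b)

/-- `G` contains an induced subdivision of `H`, i.e. some induced subgraph of `G` is
isomorphic to a subdivision of `H`. -/
def HasInducedSubdivision {V W : Type} (G : SimpleGraph V) (H : SimpleGraph W) : Prop :=
  ∃ (U : Type) (S : SimpleGraph U), IsSubdivision H S ∧ HasInducedCopy G S

/-- The average degree `2e(G)/|V(G)|` of a finite graph. -/
noncomputable def avgDeg {V : Type} (G : SimpleGraph V) [Fintype V] : ℝ :=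
  2 * G.edgeSet.ncard / Fintype.card V

namespace Sub17
section Main
open Classical

variable {V : Type} [Fintype V]

/-- neighbourhood as a finset -/
noncomputable def nb (G : SimpleGraph V) (v : V) : Finset V := Finset.univ.filter (fun u => G.Adj v u)

lemma mem_nb {G : SimpleGraph V} {u v : V} : u ∈ nb G v ↔ G.Adj v u := by simp [nb]

/-- ordered count of edges inside `S` -/
noncomputable def E2 (G : SimpleGraph V) (S : Finset V) : ℕ := ∑ x ∈ S, (nb G x ∩ S).card

/-- independent finset -/
def Indep (G : SimpleGraph V) (S : Finset V) : Prop := ∀ x ∈ S, ∀ y ∈ S, ¬ G.Adj x y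
lemma ramsey (G : SimpleGraph V) (s : ℕ) : ∀ (w : ℕ) (S : Finset V),
    (∀ Q ⊆ S, G.IsClique (Q : Set V) → Q.card ≤ w) → (w + s).choose s ≤ S.card →
    ∃ I ⊆ S, I.card = s ∧ Indep G I := by
  induction s with
  | zero =>
    intro w S _ _
    exact ⟨∅, by simp, by simp, by intro x hx; simp at hx⟩
  | succ s ih =>
    intro w
    induction w with
    | zero =>
      intro S hQ hS
      have hS : 0 < S.card := by
        have : (0 + (s+1)).choose (s+1) = 1 := by simp
        omega
      obtain ⟨v, hv⟩ := Finset.card_pos.mp hS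
      have := hQ {v} (by simpa using hv) (by simp)
      simp at this
    | succ w ihw =>
      intro S hQ hS
      have hpos : 0 < S.card := lt_of_lt_of_le (Nat.choose_pos (by omega)) hS
      obtain ⟨v, hv⟩ := Finset.card_pos.mp hpos
      set S1 := (S.erase v).filter (fun u => G.Adj v u) with hS1
      set S2 := (S.erase v).filter (fun u => ¬ G.Adj v u) with hS2
      have hc : S1.card + S2.card = S.card - 1 := by
        rw [hS1, hS2, Finset.card_filter_add_card_filter_not, Finset.card_erase_of_mem hv]
      have hch : (w + 1 + (s + 1)).choose (s + 1) = (w + 1 + s).choose s + (w + (s + 1)).choose (s + 1) := by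
        have : w + 1 + (s + 1) = (w + 1 + s) + 1 := by ring
        rw [this, Nat.choose_succ_succ]
        congr 2; ring
      by_cases h1 : (w + (s + 1)).choose (s + 1) ≤ S1.card
      · obtain ⟨I, hI, hc, hi⟩ := ihw S1 (by
          intro Q hQS hcl
          have hvQ : v ∉ Q := fun h => by
            have := hQS h
            simp [hS1] at this
          have := hQ (insert v Q) (by
            intro x hx
            rcases Finset.mem_insert.mp hx with rfl | hx
            · exact hv
            · have := hQS hx
              simp [hS1] at this
              exact this.1.2) (by
            rw [Finset.coe_insert, SimpleGraph.isClique_insert]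
            refine ⟨hcl, ?_⟩
            intro b hb _
            have := hQS hb
            simp [hS1] at this
            exact this.2)
          rw [Finset.card_insert_of_notMem hvQ] at this
          omega) h1
        refine ⟨I, fun x hx => ?_, hc, hi⟩
        have := hI hx
        simp [hS1] at this
        exact this.1.2
      · have h2 : (w + 1 + s).choose s ≤ S2.card := by omega
        obtain ⟨I, hI, hc, hi⟩ := ih (w+1) S2 (by
          intro Q hQS hcl
          refine hQ Q (fun x hx => ?_) hcl
          have := hQS hx
          simp [hS2] at this
          exact this.1.2) h2
        have hIm : ∀ x ∈ I, x ≠ v ∧ x ∈ S ∧ ¬ G.Adj v x := by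
          intro x hx
          have := hI hx
          simp [hS2] at this
          exact ⟨this.1.1, this.1.2, this.2⟩
        refine ⟨insert v I, ?_, ?_, ?_⟩
        · intro x hx
          rcases Finset.mem_insert.mp hx with rfl | hx
          · exact hv
          · exact (hIm x hx).2.1
        · rw [Finset.card_insert_of_notMem (fun h => (hIm v h).1 rfl), hc]
        · intro x hx y hy
          rcases Finset.mem_insert.mp hx with hx1 | hx1 <;> rcases Finset.mem_insert.mp hy with hy1 | hy1
          · rw [hx1, hy1]; exact G.loopless.irrefl _
          · rw [hx1]; exact (hIm y hy1).2.2
          · rw [hy1]; exact fun h => (hIm x hx1).2.2 h.symm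
          · exact hi x hx1 y hy1

/-- supersaturation of independent `r`-sets -/
lemma supersat (G : SimpleGraph V) (R r : ℕ) (hrR : r ≤ R)
    (hR : ∀ T : Finset V, R ≤ T.card → ∃ I ⊆ T, I.card = r ∧ Indep G I) (D : Finset V) (hD : R ≤ D.card) :
    D.card.choose r ≤ ((D.powersetCard r).filter (fun Q => Indep G Q)).card * R.choose r := by
  set IQ := (D.powersetCard r).filter (fun Q => Indep G Q) with hIQ
  have key : (D.powersetCard R).card * 1 ≤ IQ.card * (D.card - r).choose (R - r) := by
    apply Finset.card_mul_le_card_mul (fun (T Q : Finset V) => Q ⊆ T)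
    · intro T hT
      rw [Finset.mem_powersetCard] at hT
      obtain ⟨I, hI, hc, hi⟩ := hR T hT.2.ge
      apply Finset.card_pos.mpr
      refine ⟨I, ?_⟩
      simp only [Finset.mem_bipartiteAbove, hIQ, Finset.mem_filter, Finset.mem_powersetCard]
      exact ⟨⟨⟨hI.trans hT.1, hc⟩, hi⟩, hI⟩
    · intro Q hQ
      simp only [hIQ, Finset.mem_filter, Finset.mem_powersetCard] at hQ
      have : ((D \ Q).powersetCard (R - r)).card = (D.card - r).choose (R - r) := by
        rw [Finset.card_powersetCard, Finset.card_sdiff_of_subset hQ.1.1, hQ.1.2]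
      rw [← this]
      apply Finset.card_le_card_of_injOn (fun T => T \ Q)
      · intro T hT
        simp only [Finset.mem_bipartiteBelow, Finset.mem_coe, Finset.mem_powersetCard] at hT ⊢
        refine ⟨Finset.sdiff_subset_sdiff hT.1.1 (le_refl _), ?_⟩
        rw [Finset.card_sdiff_of_subset hT.2, hT.1.2, hQ.1.2]
      · intro T hT T' hT' h
        simp only [Finset.mem_bipartiteBelow, Finset.mem_coe, Finset.mem_powersetCard] at hT hT' h
        rw [← Finset.sdiff_union_of_subset hT.2, h, Finset.sdiff_union_of_subset hT'.2]
  rw [Finset.card_powersetCard, mul_one] at key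
  have hid := Nat.choose_mul (n := D.card) hrR
  have hp : 0 < (D.card - r).choose (R - r) := Nat.choose_pos (by omega)
  have h2 : D.card.choose r * (D.card - r).choose (R - r) ≤ (IQ.card * R.choose r) * (D.card - r).choose (R - r) := by
    rw [← hid]
    calc _ ≤ (IQ.card * (D.card - r).choose (R - r)) * R.choose r := Nat.mul_le_mul_right _ key
      _ = _ := by ring
  exact Nat.le_of_mul_le_mul_right h2 hp

/-- An induced `K_{r,t}`, as finsets. -/
def HasBic (G : SimpleGraph V) (r t : ℕ) : Prop :=
  ∃ Q C : Finset V, Q.card = r ∧ C.card = t ∧ Indep G Q ∧ Indep G C ∧ ∀ x ∈ Q, ∀ y ∈ C, G.Adj x y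

lemma few_dense (G : SimpleGraph V) (R r t : ℕ) (hrR : r ≤ R)
    (hR : ∀ T : Finset V, R ≤ T.card → ∃ I ⊆ T, I.card = r ∧ Indep G I)
    (hR' : ∀ T : Finset V, R ≤ T.card → ∃ I ⊆ T, I.card = t ∧ Indep G I)
    (hno : ¬ HasBic G r t) (S Y : Finset V) (θ : ℕ) (hθ : R ≤ θ)
    (hY : ∀ b ∈ Y, θ ≤ (nb G b ∩ S).card) :
    Y.card * (θ + 1 - r) ^ r ≤ R ^ (r + 1) * S.card ^ r := by
  set P := (S.powersetCard r).filter (fun Q => Indep G Q) with hP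
  have hcomm : ∀ Q ∈ P, (Y.filter (fun b => Q ⊆ nb G b)).card ≤ R := by
    intro Q hQ
    by_contra hcon
    push Not at hcon
    obtain ⟨C, hC, hCc, hCi⟩ := hR' _ hcon.le
    simp only [hP, Finset.mem_filter, Finset.mem_powersetCard] at hQ
    refine hno ⟨Q, C, hQ.1.2, hCc, hQ.2, hCi, ?_⟩
    intro x hx y hy
    have := hC hy
    rw [Finset.mem_filter] at this
    exact (mem_nb.mp (this.2 hx)).symm
  have h1 : ∑ b ∈ Y, (P.filter (fun Q => Q ⊆ nb G b)).card ≤ P.card * R := by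
    have : ∑ b ∈ Y, (P.filter (fun Q => Q ⊆ nb G b)).card = ∑ Q ∈ P, (Y.filter (fun b => Q ⊆ nb G b)).card :=
      Finset.sum_card_bipartiteAbove_eq_sum_card_bipartiteBelow (fun b Q => Q ⊆ nb G b)
    rw [this]
    calc _ ≤ ∑ Q ∈ P, R := Finset.sum_le_sum hcomm
      _ = _ := by simp
  have h2 : ∀ b ∈ Y, θ.choose r ≤ (P.filter (fun Q => Q ⊆ nb G b)).card * R.choose r := by
    intro b hb
    have := supersat G R r hrR hR (nb G b ∩ S) (hθ.trans (hY b hb))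
    refine (Nat.choose_le_choose r (hY b hb)).trans (this.trans ?_)
    apply Nat.mul_le_mul_right
    apply Finset.card_le_card
    intro Q hQ
    simp only [hP, Finset.mem_filter, Finset.mem_powersetCard, Finset.subset_inter_iff] at hQ ⊢
    tauto
  have h3 : Y.card * θ.choose r ≤ P.card * R * R.choose r := by
    calc Y.card * θ.choose r = ∑ b ∈ Y, θ.choose r := by simp
      _ ≤ ∑ b ∈ Y, (P.filter (fun Q => Q ⊆ nb G b)).card * R.choose r := Finset.sum_le_sum h2
      _ = (∑ b ∈ Y, (P.filter (fun Q => Q ⊆ nb G b)).card) * R.choose r := by rw [Finset.sum_mul]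
      _ ≤ _ := Nat.mul_le_mul_right _ h1
  have h4 : P.card ≤ S.card.choose r := by
    rw [← Finset.card_powersetCard]
    exact Finset.card_filter_le _ _
  have h5 : R.choose r ≤ R ^ r := Nat.choose_le_pow R r
  have h6 : Y.card * θ.choose r ≤ S.card.choose r * R ^ (r + 1) := by
    refine h3.trans ?_
    rw [pow_succ, mul_comm (R ^ r) R, ← mul_assoc]
    gcongr
  calc Y.card * (θ + 1 - r) ^ r ≤ Y.card * θ.descFactorial r := Nat.mul_le_mul_left _ (Nat.pow_sub_le_descFactorial _ _)
    _ = (Y.card * θ.choose r) * r.factorial := by rw [Nat.descFactorial_eq_factorial_mul_choose]; ring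
    _ ≤ (S.card.choose r * R ^ (r + 1)) * r.factorial := Nat.mul_le_mul_right _ h6
    _ = R ^ (r + 1) * S.card.descFactorial r := by rw [Nat.descFactorial_eq_factorial_mul_choose]; ring
    _ ≤ _ := Nat.mul_le_mul_left _ (Nat.descFactorial_le_pow _ _)

lemma exists_out_aux (G : SimpleGraph V) (k : ℕ) (h : ∀ S : Finset V, E2 G S ≤ k * S.card) :
    ∀ (n : ℕ) (S : Finset V), S.card = n → ∃ out : V → Finset V, (∀ v, out v ⊆ nb G v) ∧ (∀ v, (out v).card ≤ k) ∧
      ∀ u ∈ S, ∀ v ∈ S, G.Adj u v → v ∈ out u ∨ u ∈ out v := by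
  intro n
  induction n with
  | zero =>
    intro S hS
    rw [Finset.card_eq_zero] at hS
    subst hS
    exact ⟨fun _ => ∅, by simp, by simp, by simp⟩
  | succ n ih =>
    intro S hS
    have hne : S.Nonempty := by
      rw [← Finset.card_pos]; omega
    have : ∃ v ∈ S, (nb G v ∩ S).card ≤ k := by
      apply Finset.exists_le_of_sum_le hne
      have := h S
      simp only [E2] at this
      simpa [mul_comm] using this
    obtain ⟨v, hv, hvk⟩ := this
    obtain ⟨out, h1, h2, h3⟩ := ih (S.erase v) (by rw [Finset.card_erase_of_mem hv]; omega)
    refine ⟨Function.update out v (nb G v ∩ S), ?_, ?_, ?_⟩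
    · intro u
      by_cases hu : u = v
      · subst hu; simp
      · simpa [hu] using h1 u
    · intro u
      by_cases hu : u = v
      · subst hu; simpa using hvk
      · simpa [hu] using h2 u
    · intro x hx y hy hxy
      by_cases hxv : x = v
      · subst hxv
        left
        simp [mem_nb, hxy, hy]
      · by_cases hyv : y = v
        · subst hyv
          right
          simp [mem_nb, hxy.symm, hx]
        · simpa [hxv, hyv] using h3 x (by simp [hxv, hx]) y (by simp [hyv, hy]) hxy

lemma exists_out (G : SimpleGraph V) (k : ℕ) (h : ∀ S : Finset V, E2 G S ≤ k * S.card) :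
    ∃ out : V → Finset V, (∀ v, out v ⊆ nb G v) ∧ (∀ v, (out v).card ≤ k) ∧
      ∀ u v, G.Adj u v → v ∈ out u ∨ u ∈ out v := by
  obtain ⟨out, h1, h2, h3⟩ := exists_out_aux G k h _ Finset.univ rfl
  exact ⟨out, h1, h2, fun u v => h3 u (by simp) v (by simp)⟩

lemma indep_of_out {α : Type} (conf : α → α → Prop) (Q : ℕ) : ∀ (n : ℕ) (S : Finset α), S.card = n →
    (∀ a ∈ S, (S.filter (fun b => conf a b)).card ≤ Q) →
    ∃ I ⊆ S, (∀ a ∈ I, ∀ b ∈ I, a ≠ b → ¬ conf a b) ∧ S.card ≤ (2 * Q + 1) * I.card := by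
  intro n
  induction n using Nat.strong_induction_on with
  | _ n ih =>
    intro S hS hQ
    rcases S.eq_empty_or_nonempty with rfl | hne
    · exact ⟨∅, by simp, by simp, by simp⟩
    have hsum : ∑ a ∈ S, ((S.filter (fun b => conf a b)).card + (S.filter (fun b => conf b a)).card) ≤ ∑ a ∈ S, (2 * Q) := by
      rw [Finset.sum_add_distrib]
      have e : ∑ a ∈ S, (S.filter (fun b => conf b a)).card = ∑ a ∈ S, (S.filter (fun b => conf a b)).card :=
        (Finset.sum_card_bipartiteAbove_eq_sum_card_bipartiteBelow (fun a b => conf a b)).symm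
      rw [e]
      have := Finset.sum_le_sum hQ
      simp only [Finset.sum_const, smul_eq_mul] at this ⊢
      linarith
    obtain ⟨a, ha, hle⟩ := Finset.exists_le_of_sum_le hne hsum
    set S' := S.filter (fun b => b ≠ a ∧ ¬ conf a b ∧ ¬ conf b a) with hS'
    have hsub : S ⊆ insert a ((S.filter (fun b => conf a b)) ∪ (S.filter (fun b => conf b a))) ∪ S' := by
      intro b hb
      simp only [Finset.mem_union, Finset.mem_insert, Finset.mem_filter, hS', hb, true_and]
      tauto
    have hc : S.card ≤ (2 * Q + 1) + S'.card := by
      refine (Finset.card_le_card hsub).trans ((Finset.card_union_le _ _).trans ?_)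
      have h1 := Finset.card_insert_le a ((S.filter (fun b => conf a b)) ∪ (S.filter (fun b => conf b a)))
      have h2 := Finset.card_union_le (S.filter (fun b => conf a b)) (S.filter (fun b => conf b a))
      omega
    have hlt : S'.card < n := by
      rw [← hS]
      apply Finset.card_lt_card
      refine ⟨Finset.filter_subset _ _, fun h => ?_⟩
      have := h ha
      simp [hS'] at this
    obtain ⟨I, hI, hind, hcard⟩ := ih _ hlt S' rfl (by
      intro b hb
      refine le_trans (Finset.card_le_card ?_) (hQ b (Finset.mem_filter.mp hb).1)
      exact Finset.filter_subset_filter _ (Finset.filter_subset _ _))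
    have hIm : ∀ b ∈ I, b ∈ S ∧ b ≠ a ∧ ¬ conf a b ∧ ¬ conf b a := by
      intro b hb
      simpa [hS'] using hI hb
    refine ⟨insert a I, ?_, ?_, ?_⟩
    · intro b hb
      rcases Finset.mem_insert.mp hb with rfl | hb
      · exact ha
      · exact (hIm b hb).1
    · intro x hx y hy hxy
      rcases Finset.mem_insert.mp hx with hx1 | hx1 <;> rcases Finset.mem_insert.mp hy with hy1 | hy1
      · exact absurd (hx1.trans hy1.symm) hxy
      · rw [hx1]; exact (hIm y hy1).2.2.1
      · rw [hy1]; exact (hIm x hx1).2.2.2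
      · exact hind x hx1 y hy1 hxy
    · rw [Finset.card_insert_of_notMem (fun h => (hIm a h).2.1 rfl)]
      linarith [hc, hcard]

/-- pruning a bipartite incidence relation to large minimum degree on both sides -/
lemma prune (Γ : V → V → Prop) (m : ℕ) : ∀ (n : ℕ) (A H : Finset V), A.card + H.card = n →
    m * (A.card + H.card) < ∑ a ∈ A, (H.filter (fun b => Γ a b)).card →
    ∃ A' ⊆ A, ∃ H' ⊆ H, H'.Nonempty ∧ (∀ a ∈ A', m ≤ (H'.filter (fun b => Γ a b)).card) ∧
      (∀ b ∈ H', m ≤ (A'.filter (fun a => Γ a b)).card) := by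
  intro n
  induction n with
  | zero =>
    intro A H hn h
    have : A = ∅ := by rw [← Finset.card_eq_zero]; omega
    subst this
    simp at h
  | succ n ih =>
    intro A H hn h
    by_cases h1 : ∀ a ∈ A, m ≤ (H.filter (fun b => Γ a b)).card
    · by_cases h2 : ∀ b ∈ H, m ≤ (A.filter (fun a => Γ a b)).card
      · refine ⟨A, le_refl _, H, le_refl _, ?_, h1, h2⟩
        rw [Finset.nonempty_iff_ne_empty]
        rintro rfl
        simp at h
      · push Not at h2
        obtain ⟨b, hb, hbm⟩ := h2
        have e : ∑ a ∈ A, (H.filter (fun b => Γ a b)).card = ∑ b ∈ H, (A.filter (fun a => Γ a b)).card :=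
          Finset.sum_card_bipartiteAbove_eq_sum_card_bipartiteBelow Γ
        have e' : ∑ a ∈ A, ((H.erase b).filter (fun b => Γ a b)).card = ∑ b ∈ H.erase b, (A.filter (fun a => Γ a b)).card :=
          Finset.sum_card_bipartiteAbove_eq_sum_card_bipartiteBelow Γ
        rw [e, ← Finset.add_sum_erase H _ hb, ← e'] at h
        have hc : (H.erase b).card + 1 = H.card := Finset.card_erase_add_one hb
        obtain ⟨A', hA', H', hH', hh⟩ := ih A (H.erase b) (by omega) (by
          rw [← hc] at h
          have : m * (A.card + ((H.erase b).card + 1)) = m * (A.card + (H.erase b).card) + m := by ring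
          omega)
        exact ⟨A', hA', H', hH'.trans (Finset.erase_subset _ _), hh⟩
    · push Not at h1
      obtain ⟨a, ha, ham⟩ := h1
      rw [← Finset.add_sum_erase A _ ha] at h
      have hc : (A.erase a).card + 1 = A.card := Finset.card_erase_add_one ha
      obtain ⟨A', hA', H', hH', hh⟩ := ih (A.erase a) H (by omega) (by
        rw [← hc] at h
        have : m * ((A.erase a).card + 1 + H.card) = m * ((A.erase a).card + H.card) + m := by ring
        omega)
      exact ⟨A', hA'.trans (Finset.erase_subset _ _), H', hH', hh⟩

noncomputable def samp {M : ℕ} [NeZero M] (f : V → Fin M) : Finset V := Finset.univ.filter (fun v => f v = 0)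

/-- functions whose sampled set contains `J` -/
noncomputable def fs (M : ℕ) [NeZero M] (J : Finset V) : Finset (V → Fin M) :=
  Finset.univ.filter (fun f => J ⊆ samp f)

lemma card_fs (M : ℕ) [NeZero M] (J : Finset V) : (fs M J).card * M ^ J.card = M ^ (Fintype.card V) := by
  have : fs M J = Fintype.piFinset (fun v => if v ∈ J then ({0} : Finset (Fin M)) else Finset.univ) := by
    ext f
    simp only [fs, Finset.mem_filter, Finset.mem_univ, true_and, Fintype.mem_piFinset]
    constructor
    · intro h v
      by_cases hv : v ∈ J
      · have := h hv
        simp [samp] at this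
        simp [hv, this]
      · simp [hv]
    · intro h v hv
      have := h v
      simpa [hv, samp] using this
  rw [this, Fintype.card_piFinset]
  have e : ∀ v, (if v ∈ J then ({0} : Finset (Fin M)) else Finset.univ).card = if v ∈ J then 1 else M := by
    intro v; split_ifs <;> simp
  simp only [e]
  rw [Finset.prod_ite]
  simp only [Finset.prod_const, one_pow, one_mul, ← pow_add]
  congr 1
  have h2 := Finset.card_filter_add_card_filter_not (s := (Finset.univ : Finset V)) (fun v => v ∈ J)
  simp only [Finset.filter_univ_mem, Finset.card_univ] at h2
  omega

lemma card_fs_insert (M : ℕ) [NeZero M] (J : Finset V) (x : V) (hx : x ∉ J) :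
    (fs M (insert x J)).card * M = (fs M J).card := by
  have h1 := card_fs M J
  have h2 := card_fs M (insert x J)
  rw [Finset.card_insert_of_notMem hx, pow_succ] at h2
  have hM : 0 < M ^ J.card := Nat.pow_pos (Nat.pos_of_ne_zero (NeZero.ne M))
  apply Nat.eq_of_mul_eq_mul_right hM
  rw [h1, ← h2]; ring

lemma triple_count (G : SimpleGraph V) (M : ℕ) [NeZero M] (b b' : V) (X O : Finset V) (Δ θ κ T : ℕ)
    (hbX : b ∉ X) (hbX' : b' ∉ X) (hX : 8 * X.card ≤ M)
    (hO : ∀ y ∈ O, (nb G y).card ≤ Δ)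
    (hOb : (O.filter (fun y => b ∈ nb G y ∨ b' ∈ nb G y)).card ≤ 2 * θ)
    (hκ : O.card * Δ ^ 2 ≤ κ * M ^ 2) (hT : 4 * (2 * θ + κ) ≤ T + 1) :
    (fs M {b, b'}).card ≤ 2 * ((fs M {b, b'}).filter (fun f => Disjoint X (samp f) ∧
      (O.filter (fun y => 2 ≤ (nb G y ∩ samp f).card)).card ≤ T)).card := by
  have hMpos : 0 < M := Nat.pos_of_ne_zero (NeZero.ne M)
  set J : Finset V := {b, b'} with hJ
  set C := (fs M J).card with hC
  set good := (fs M J).filter (fun f => Disjoint X (samp f) ∧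
      (O.filter (fun y => 2 ≤ (nb G y ∩ samp f).card)).card ≤ T) with hgood
  set bad1 := (fs M J).filter (fun f => ¬ Disjoint X (samp f)) with hbad1
  set bad3 := (fs M J).filter (fun f => T + 1 ≤ (O.filter (fun y => 2 ≤ (nb G y ∩ samp f).card)).card) with hbad3
  have hsplit : C ≤ good.card + bad1.card + bad3.card := by
    have : fs M J ⊆ good ∪ bad1 ∪ bad3 := by
      intro f hf
      simp only [hgood, hbad1, hbad3, Finset.mem_union, Finset.mem_filter, hf, true_and]
      by_cases h1 : Disjoint X (samp f)
      · by_cases h2 : (O.filter (fun y => 2 ≤ (nb G y ∩ samp f).card)).card ≤ T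
        · tauto
        · right; omega
      · tauto
    refine (Finset.card_le_card this).trans ((Finset.card_union_le _ _).trans ?_)
    have := Finset.card_union_le good bad1
    omega
  have hb1 : 8 * bad1.card ≤ C := by
    have hsub : bad1 ⊆ X.biUnion (fun x => fs M (insert x J)) := by
      intro f hf
      simp only [hbad1, Finset.mem_filter, Finset.not_disjoint_iff] at hf
      obtain ⟨hf, x, hx, hxs⟩ := hf
      simp only [Finset.mem_biUnion]
      refine ⟨x, hx, ?_⟩
      simp only [fs, Finset.mem_filter, Finset.mem_univ, true_and] at hf ⊢
      exact Finset.insert_subset hxs hf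
    have h1 : bad1.card ≤ ∑ x ∈ X, (fs M (insert x J)).card := (Finset.card_le_card hsub).trans Finset.card_biUnion_le
    have h2 : bad1.card * M ≤ X.card * C := by
      calc bad1.card * M ≤ (∑ x ∈ X, (fs M (insert x J)).card) * M := Nat.mul_le_mul_right _ h1
        _ = ∑ x ∈ X, C := by
          rw [Finset.sum_mul]
          apply Finset.sum_congr rfl
          intro x hx
          apply card_fs_insert
          simp only [hJ, Finset.mem_insert, Finset.mem_singleton, not_or]
          exact ⟨fun h => hbX (h ▸ hx), fun h => hbX' (h ▸ hx)⟩
        _ = _ := by simp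
    apply Nat.le_of_mul_le_mul_right _ hMpos
    calc 8 * bad1.card * M = 8 * (bad1.card * M) := by ring
      _ ≤ 8 * (X.card * C) := by omega
      _ = (8 * X.card) * C := by ring
      _ ≤ M * C := Nat.mul_le_mul_right _ hX
      _ = C * M := by ring
  have hy : ∀ y ∈ O, ¬ (b ∈ nb G y ∨ b' ∈ nb G y) →
      ((fs M J).filter (fun f => 2 ≤ (nb G y ∩ samp f).card)).card * M ^ 2 ≤ Δ ^ 2 * C := by
    intro y hyO hyb
    push Not at hyb
    have hsub : (fs M J).filter (fun f => 2 ≤ (nb G y ∩ samp f).card) ⊆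
        ((nb G y).offDiag).biUnion (fun p => fs M (insert p.1 (insert p.2 J))) := by
      intro f hf
      simp only [Finset.mem_filter] at hf
      obtain ⟨hf, h2⟩ := hf
      obtain ⟨u, hu, v, hv, huv⟩ := Finset.one_lt_card.mp h2
      simp only [Finset.mem_inter] at hu hv
      simp only [Finset.mem_biUnion]
      refine ⟨(u, v), by simp [hu.1, hv.1, huv], ?_⟩
      simp only [fs, Finset.mem_filter, Finset.mem_univ, true_and] at hf ⊢
      exact Finset.insert_subset hu.2 (Finset.insert_subset hv.2 hf)
    have h1 := (Finset.card_le_card hsub).trans Finset.card_biUnion_le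
    have hoff : (nb G y).offDiag.card ≤ Δ ^ 2 := by
      rw [Finset.offDiag_card]
      have := Nat.mul_le_mul (hO y hyO) (hO y hyO)
      rw [sq]; omega
    calc _ ≤ (∑ p ∈ (nb G y).offDiag, (fs M (insert p.1 (insert p.2 J))).card) * M ^ 2 := Nat.mul_le_mul_right _ h1
      _ = ∑ p ∈ (nb G y).offDiag, C := by
        rw [Finset.sum_mul]
        apply Finset.sum_congr rfl
        intro p hp
        simp only [Finset.mem_offDiag] at hp
        have n2 : p.2 ∉ J := by
          simp only [hJ, Finset.mem_insert, Finset.mem_singleton, not_or]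
          exact ⟨fun h => hyb.1 (h ▸ hp.2.1), fun h => hyb.2 (h ▸ hp.2.1)⟩
        have n1 : p.1 ∉ insert p.2 J := by
          simp only [hJ, Finset.mem_insert, Finset.mem_singleton, not_or]
          exact ⟨hp.2.2, fun h => hyb.1 (h ▸ hp.1), fun h => hyb.2 (h ▸ hp.1)⟩
        rw [sq, ← mul_assoc, card_fs_insert M _ _ n1, card_fs_insert M _ _ n2]
      _ = (nb G y).offDiag.card * C := by simp
      _ ≤ _ := Nat.mul_le_mul_right _ hoff
  have hb3 : 4 * bad3.card ≤ C := by
    have h1 : bad3.card * (T + 1) ≤ ∑ y ∈ O, ((fs M J).filter (fun f => 2 ≤ (nb G y ∩ samp f).card)).card := by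
      have e : ∑ y ∈ O, ((fs M J).filter (fun f => 2 ≤ (nb G y ∩ samp f).card)).card
          = ∑ f ∈ fs M J, (O.filter (fun y => 2 ≤ (nb G y ∩ samp f).card)).card :=
        Finset.sum_card_bipartiteAbove_eq_sum_card_bipartiteBelow (fun y f => 2 ≤ (nb G y ∩ samp f).card)
      rw [e]
      calc bad3.card * (T + 1) = ∑ f ∈ bad3, (T + 1) := by simp
        _ ≤ ∑ f ∈ bad3, (O.filter (fun y => 2 ≤ (nb G y ∩ samp f).card)).card := by
          apply Finset.sum_le_sum
          intro f hf
          exact (Finset.mem_filter.mp hf).2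
        _ ≤ _ := Finset.sum_le_sum_of_subset (Finset.filter_subset _ _)
    have h2 : (bad3.card * (T + 1)) * M ^ 2 ≤ (2 * θ + κ) * C * M ^ 2 := by
      refine (Nat.mul_le_mul_right _ h1).trans ?_
      rw [← Finset.sum_filter_add_sum_filter_not O (fun y => b ∈ nb G y ∨ b' ∈ nb G y), add_mul]
      have p1 : (∑ y ∈ O.filter (fun y => b ∈ nb G y ∨ b' ∈ nb G y), ((fs M J).filter (fun f => 2 ≤ (nb G y ∩ samp f).card)).card) ≤ 2 * θ * C := by
        calc _ ≤ ∑ y ∈ O.filter (fun y => b ∈ nb G y ∨ b' ∈ nb G y), C :=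
              Finset.sum_le_sum (fun y _ => Finset.card_filter_le _ _)
          _ = (O.filter (fun y => b ∈ nb G y ∨ b' ∈ nb G y)).card * C := by simp
          _ ≤ _ := Nat.mul_le_mul_right _ hOb
      have p2 : (∑ y ∈ O.filter (fun y => ¬ (b ∈ nb G y ∨ b' ∈ nb G y)), ((fs M J).filter (fun f => 2 ≤ (nb G y ∩ samp f).card)).card) * M ^ 2 ≤ κ * M ^ 2 * C := by
        rw [Finset.sum_mul]
        calc _ ≤ ∑ y ∈ O.filter (fun y => ¬ (b ∈ nb G y ∨ b' ∈ nb G y)), Δ ^ 2 * C := by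
              apply Finset.sum_le_sum
              intro y hy'
              rw [Finset.mem_filter] at hy'
              exact hy y hy'.1 hy'.2
          _ = (O.filter (fun y => ¬ (b ∈ nb G y ∨ b' ∈ nb G y))).card * (Δ ^ 2 * C) := by simp
          _ ≤ O.card * (Δ ^ 2 * C) := Nat.mul_le_mul_right _ (Finset.card_filter_le _ _)
          _ = (O.card * Δ ^ 2) * C := by ring
          _ ≤ _ := Nat.mul_le_mul_right _ hκ
      calc _ ≤ 2 * θ * C * M ^ 2 + κ * M ^ 2 * C := Nat.add_le_add (Nat.mul_le_mul_right _ p1) p2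
        _ = _ := by ring
    have h3 : bad3.card * (T + 1) ≤ (2 * θ + κ) * C :=
      Nat.le_of_mul_le_mul_right h2 (Nat.pow_pos hMpos)
    have hTpos : 0 < T + 1 := by omega
    apply Nat.le_of_mul_le_mul_right _ hTpos
    calc 4 * bad3.card * (T + 1) = 4 * (bad3.card * (T + 1)) := by ring
      _ ≤ 4 * ((2 * θ + κ) * C) := by omega
      _ = (4 * (2 * θ + κ)) * C := by ring
      _ ≤ (T + 1) * C := Nat.mul_le_mul_right _ hT
      _ = _ := by ring
  omega

lemma E2_univ (G : SimpleGraph V) : E2 G Finset.univ = ∑ v, (nb G v).card := by simp [E2]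

/-- the incidence relation: adjacent and with few common neighbours -/
def Gam (G : SimpleGraph V) (x : ℕ) (a b : V) : Prop := G.Adj a b ∧ (nb G a ∩ nb G b).card < x

lemma count_gam (G : SimpleGraph V) (z x d : ℕ) (hz : 200 ≤ z) (hx : 1 ≤ x) (hd : d = z ^ 14 * x)
    (hE : ∀ S : Finset V, E2 G S ≤ 4 * d * S.card) (hn : d * Fintype.card V ≤ E2 G Finset.univ)
    (hV : 0 < Fintype.card V)
    (hD : ∀ S Y : Finset V, S.card ≤ z * d → (∀ b ∈ Y, x ≤ (nb G b ∩ S).card) → Y.card ≤ x)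
    (A : Finset V) (hA : A = Finset.univ.filter (fun v => (nb G v).card ≤ z * d)) :
    (z ^ 13 * x) * (A.card + (Finset.univ : Finset V).card) <
      ∑ a ∈ A, ((Finset.univ : Finset V).filter (fun b => Gam G x a b)).card := by
  have hdpos : 0 < d := by rw [hd]; positivity
  set n := Fintype.card V with hn'
  have hAc : ∀ v ∈ Aᶜ, z * d ≤ (nb G v).card := by
    intro v hv
    simp [hA] at hv
    exact hv.le
  have hsplit : ∑ v ∈ A, (nb G v).card + ∑ v ∈ Aᶜ, (nb G v).card = E2 G Finset.univ := by
    rw [E2_univ, Finset.sum_add_sum_compl]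
  have h1 : Aᶜ.card * (z * d) ≤ 4 * d * n := by
    calc Aᶜ.card * (z * d) = ∑ v ∈ Aᶜ, z * d := by simp
      _ ≤ ∑ v ∈ Aᶜ, (nb G v).card := Finset.sum_le_sum hAc
      _ ≤ E2 G Finset.univ := by omega
      _ ≤ 4 * d * n := by simpa using hE Finset.univ
  have h1' : 8 * (4 * d * Aᶜ.card) ≤ d * n := by
    have : (200 * d * Aᶜ.card) ≤ Aᶜ.card * (z * d) := by
      calc _ = Aᶜ.card * (200 * d) := by ring
        _ ≤ _ := by gcongr
    nlinarith
  have h2 : ∑ v ∈ Aᶜ, (nb G v).card ≤ ∑ v ∈ A, (nb G v).card + E2 G Aᶜ := by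
    have e1 : ∀ v, (nb G v).card = (nb G v ∩ A).card + (nb G v ∩ Aᶜ).card := by
      intro v
      rw [← Finset.sdiff_eq_inter_compl, Finset.card_inter_add_card_sdiff]
    have e2 : ∑ v ∈ Aᶜ, (nb G v ∩ A).card = ∑ a ∈ A, (nb G a ∩ Aᶜ).card := by
      have := Finset.sum_card_bipartiteAbove_eq_sum_card_bipartiteBelow (s := Aᶜ) (t := A) (fun u v => G.Adj u v)
      convert this using 2 with v hv a ha
      · congr 1; ext u; simp [Finset.bipartiteAbove, mem_nb, and_comm]
      · congr 1; ext u; simp [Finset.bipartiteBelow, mem_nb, and_comm, G.adj_comm]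
    calc ∑ v ∈ Aᶜ, (nb G v).card = ∑ v ∈ Aᶜ, (nb G v ∩ A).card + ∑ v ∈ Aᶜ, (nb G v ∩ Aᶜ).card := by
          rw [← Finset.sum_add_distrib]; exact Finset.sum_congr rfl (fun v _ => e1 v)
      _ ≤ _ := by
        rw [e2]
        apply Nat.add_le_add
        · apply Finset.sum_le_sum
          intro a _
          exact Finset.card_le_card Finset.inter_subset_left
        · exact le_refl _
  have h3 : d * n ≤ 4 * ∑ v ∈ A, (nb G v).card := by
    have := hE Aᶜ
    omega
  have h4 : ∀ a ∈ A, (nb G a).card ≤ ((Finset.univ : Finset V).filter (fun b => Gam G x a b)).card + x := by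
    intro a ha
    have hb := hD (nb G a) (Finset.univ.filter (fun b => x ≤ (nb G b ∩ nb G a).card)) (by
      rw [hA] at ha; exact (Finset.mem_filter.mp ha).2) (by
      intro b hb; exact (Finset.mem_filter.mp hb).2)
    refine le_trans ?_ (Nat.add_le_add_left hb _)
    refine le_trans (Finset.card_le_card ?_) (Finset.card_union_le _ _)
    intro b hb
    rw [mem_nb] at hb
    rw [Finset.mem_union]
    by_cases h : (nb G a ∩ nb G b).card < x
    · left; exact Finset.mem_filter.mpr ⟨Finset.mem_univ _, hb, h⟩
    · right
      rw [Finset.mem_filter, Finset.inter_comm (nb G b)]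
      exact ⟨Finset.mem_univ _, by omega⟩
  have h5 : ∑ v ∈ A, (nb G v).card ≤ ∑ a ∈ A, ((Finset.univ : Finset V).filter (fun b => Gam G x a b)).card + A.card * x := by
    refine (Finset.sum_le_sum h4).trans ?_
    rw [Finset.sum_add_distrib]; simp
  have hAn : A.card ≤ n := Finset.card_le_univ A
  set m := z ^ 13 * x with hm
  have hdm : d = z * m := by rw [hd, hm]; ring
  have hxm : x ≤ m := by
    rw [hm]; exact Nat.le_mul_of_pos_left _ (by positivity)
  rw [Finset.card_univ]
  have h6 : 200 * m * n ≤ d * n := by rw [hdm]; gcongr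
  have h7 : m * (A.card + n) ≤ 2 * (m * n) := by nlinarith
  have h8 : A.card * x ≤ m * n := by nlinarith
  have h9 : 0 < m * n := by
    apply Nat.mul_pos _ hV
    omega
  nlinarith

/-- Triples and sampling. -/
lemma exists_sample (G : SimpleGraph V) (z x d : ℕ) (hz : 200 ≤ z) (hx : 1 ≤ x) (hd : d = z ^ 14 * x)
    (hD : ∀ S Y : Finset V, S.card ≤ z * d → (∀ b ∈ Y, x ≤ (nb G b ∩ S).card) → Y.card ≤ x)
    (out : V → Finset V) (hout : ∀ v, out v ⊆ nb G v) (houtc : ∀ v, (out v).card ≤ 4 * d)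
    (A A' H : Finset V) (hA : ∀ a ∈ A, (nb G a).card ≤ z * d) (hAA : A' ⊆ A) (hH : H.Nonempty)
    (h1 : ∀ a ∈ A', z ^ 13 * x ≤ (H.filter (fun b => Gam G x a b)).card)
    (N' : V → Finset V) (hN' : ∀ b ∈ H, N' b ⊆ A'.filter (fun a => Gam G x a b))
    (hN'c : ∀ b ∈ H, (N' b).card = z ^ 13 * x) :
    ∃ (B0 : Finset V) (TG : Finset (V × V × V)),
      (z ^ 13 * x) ^ 2 * (B0 ∩ H).card < 8 * (z ^ 22 * x) * TG.card ∧
      ∀ t ∈ TG, t.2.1 ∈ H ∧ t.2.2 ∈ H ∧ t.2.1 ∈ B0 ∧ t.2.2 ∈ B0 ∧ t.1 ∈ N' t.2.1 ∧ G.Adj t.1 t.2.2 ∧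
        t.2.1 ≠ t.2.2 ∧ ¬ G.Adj t.2.1 t.2.2 ∧ (N' t.2.1 ∩ nb G t.2.2).card < x ∧
        Disjoint ((nb G t.1 ∪ out t.2.1 ∪ out t.2.2) \ {t.2.1, t.2.2}) B0 ∧
        ((out t.1 ∩ A).filter (fun y => 2 ≤ (nb G y ∩ B0).card)).card ≤ z * x := by
  set m := z ^ 13 * x with hm
  set M := z ^ 22 * x with hM
  have hMpos : 0 < M := by positivity
  haveI : NeZero M := ⟨hMpos.ne'⟩
  have hdm : d = z * m := by rw [hd, hm]; ring
  have hdpos : 0 < d := by rw [hd]; positivity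
  have hxm : 200 * x ≤ m := by
    rw [hm]
    have : 200 ≤ z ^ 13 := hz.trans (Nat.le_self_pow (by norm_num) z)
    gcongr
  have hmpos : 0 < m := by omega
  -- triples
  let Wf : V → V → Finset V := fun b a => H.filter (fun b' => Gam G x a b' ∧ b ≠ b' ∧ ¬ G.Adj b b' ∧ (N' b ∩ nb G b').card < x)
  have hW : ∀ b ∈ H, ∀ a ∈ N' b, m ≤ 2 * (Wf b a).card := by
    intro b hb a ha
    have ha' := Finset.mem_filter.mp (hN' b hb ha)
    have c1 := h1 a ha'.1
    have c2 := ha'.2.2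
    have c3 := hD (N' b) (Finset.univ.filter (fun b' => x ≤ (nb G b' ∩ N' b).card)) (by
      rw [hN'c b hb, hdm]; nlinarith) (by intro b hb; exact (Finset.mem_filter.mp hb).2)
    have hsub : H.filter (fun b => Gam G x a b) ⊆ Wf b a ∪ ({b} ∪ ((nb G a ∩ nb G b) ∪
        (Finset.univ.filter (fun b' => x ≤ (nb G b' ∩ N' b).card)))) := by
      intro b' hb'
      simp only [Finset.mem_filter] at hb'
      simp only [Wf, Finset.mem_union, Finset.mem_filter, Finset.mem_singleton, Finset.mem_inter, Finset.mem_univ, true_and, mem_nb]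
      rw [Finset.inter_comm (nb G b')]
      by_cases e1 : b' = b
      · tauto
      · by_cases e2 : G.Adj b b'
        · have := hb'.2.1; tauto
        · by_cases e3 : (N' b ∩ nb G b').card < x
          · left
            exact ⟨hb'.1, hb'.2, fun h => e1 h.symm, e2, e3⟩
          · right; right; right; omega
    have c4 := Finset.card_le_card hsub
    have c5 := Finset.card_union_le (Wf b a) ({b} ∪ ((nb G a ∩ nb G b) ∪
        (Finset.univ.filter (fun b' => x ≤ (nb G b' ∩ N' b).card))))
    have c6 := Finset.card_union_le {b} ((nb G a ∩ nb G b) ∪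
        (Finset.univ.filter (fun b' => x ≤ (nb G b' ∩ N' b).card)))
    have c7 := Finset.card_union_le (nb G a ∩ nb G b) (Finset.univ.filter (fun b' => x ≤ (nb G b' ∩ N' b).card))
    have c8 : ({b} : Finset V).card = 1 := Finset.card_singleton b
    omega
  let Trip : Finset (V × V × V) := Finset.univ.filter (fun t => t.2.1 ∈ H ∧ t.1 ∈ N' t.2.1 ∧ t.2.2 ∈ Wf t.2.1 t.1)
  have hTrip : H.card * m ^ 2 ≤ 2 * Trip.card := by
    let Ts : Finset (Σ _ : V, Σ _ : V, V) := H.sigma (fun b => (N' b).sigma (fun a => Wf b a))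
    have hc : Ts.card ≤ Trip.card := by
      apply Finset.card_le_card_of_injOn (fun s => (s.2.1, s.1, s.2.2))
      · rintro ⟨b, a, b'⟩ hs
        simp only [Ts, Finset.mem_coe, Finset.mem_sigma] at hs
        simp only [Trip, Finset.mem_coe, Finset.mem_filter, Finset.mem_univ, true_and]
        exact hs
      · rintro ⟨b, a, b'⟩ _ ⟨c, e, c'⟩ _ h
        simp only [Prod.mk.injEq] at h
        obtain ⟨rfl, rfl, rfl⟩ := h
        rfl
    have hs : Ts.card = ∑ b ∈ H, ∑ a ∈ N' b, (Wf b a).card := by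
      simp only [Ts, Finset.card_sigma]
    have : H.card * m ^ 2 ≤ 2 * ∑ b ∈ H, ∑ a ∈ N' b, (Wf b a).card := by
      rw [Finset.mul_sum]
      calc H.card * m ^ 2 = ∑ b ∈ H, m ^ 2 := by simp
        _ ≤ _ := by
          apply Finset.sum_le_sum
          intro b hb
          rw [Finset.mul_sum]
          calc m ^ 2 = ∑ a ∈ N' b, m := by simp [hN'c b hb, sq]
            _ ≤ _ := Finset.sum_le_sum (fun a ha => hW b hb a ha)
    omega
  let good : (V → Fin M) → V × V × V → Prop := fun f t =>
    f ∈ fs M {t.2.1, t.2.2} ∧ Disjoint ((nb G t.1 ∪ out t.2.1 ∪ out t.2.2) \ {t.2.1, t.2.2}) (samp f) ∧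
        ((out t.1 ∩ A).filter (fun y => 2 ≤ (nb G y ∩ samp f).card)).card ≤ z * x
  set n := Fintype.card V with hn
  have hgood : ∀ t ∈ Trip, M ^ n ≤ 2 * M ^ 2 * (Finset.univ.filter (fun f => good f t)).card := by
    rintro ⟨a, b, b'⟩ ht
    simp only [Trip, Wf, Finset.mem_filter, Finset.mem_univ, true_and] at ht
    obtain ⟨hb, ha, hb', hg', hbb', hnadj, hN⟩ := ht
    have ha' := Finset.mem_filter.mp (hN' b hb ha)
    have haA : a ∈ A := hAA ha'.1
    have := triple_count G M b b' ((nb G a ∪ out b ∪ out b') \ {b, b'}) (out a ∩ A) (z * d) x (4 * x) (z * x)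
      (by simp) (by simp) (by
        have c0 : ((nb G a ∪ out b ∪ out b') \ {b, b'}).card ≤ z * d + 4 * d + 4 * d := by
          refine (Finset.card_le_card Finset.sdiff_subset).trans ((Finset.card_union_le _ _).trans ?_)
          have := Finset.card_union_le (nb G a) (out b)
          have := hA a haA
          have := houtc b
          have := houtc b'
          omega
        have c1 : 8 * (z * d + 4 * d + 4 * d) ≤ z ^ 8 * d := by
          have : 8 * (z + 8) ≤ z ^ 8 := by
            calc 8 * (z + 8) ≤ z * z := by nlinarith
              _ = z ^ 2 := by ring
              _ ≤ z ^ 8 := Nat.pow_le_pow_right (by omega) (by norm_num)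
          calc _ = (8 * (z + 8)) * d := by ring
            _ ≤ _ := Nat.mul_le_mul_right _ this
        have c2 : M = z ^ 8 * d := by rw [hM, hd]; ring
        rw [c2]; omega)
      (by intro y hy; exact hA y (Finset.mem_inter.mp hy).2)
      (by
        have hs : (out a ∩ A).filter (fun y => b ∈ nb G y ∨ b' ∈ nb G y) ⊆ (nb G a ∩ nb G b) ∪ (nb G a ∩ nb G b') := by
          intro y hy
          simp only [Finset.mem_filter, Finset.mem_inter, mem_nb] at hy
          have hya := mem_nb.mp (hout a hy.1.1)
          simp only [Finset.mem_union, Finset.mem_inter, mem_nb]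
          rcases hy.2 with h | h
          · left; exact ⟨hya, h.symm⟩
          · right; exact ⟨hya, h.symm⟩
        have c1 := Finset.card_le_card hs
        have c2 := Finset.card_union_le (nb G a ∩ nb G b) (nb G a ∩ nb G b')
        have c3 := ha'.2.2
        have c4 := hg'.2
        omega)
      (by
        have c1 : (out a ∩ A).card ≤ 4 * d := (Finset.card_le_card Finset.inter_subset_left).trans (houtc a)
        calc (out a ∩ A).card * (z * d) ^ 2 ≤ (4 * d) * (z * d) ^ 2 := Nat.mul_le_mul_right _ c1
          _ = 4 * x * M ^ 2 := by rw [hM, hd]; ring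
          _ ≤ _ := le_refl _)
      (by nlinarith)
    have hcard := card_fs M ({b, b'} : Finset V)
    rw [Finset.card_pair hbb'] at hcard
    have e : (Finset.univ.filter (fun f => good f (a, b, b'))) = ((fs M {b, b'}).filter (fun f => Disjoint ((nb G a ∪ out b ∪ out b') \ {b, b'}) (samp f) ∧
      ((out a ∩ A).filter (fun y => 2 ≤ (nb G y ∩ samp f).card)).card ≤ z * x)) := by
      ext f
      simp [good]
    rw [e, ← hcard]
    calc _ ≤ (2 * _) * M ^ 2 := Nat.mul_le_mul_right _ this
      _ = _ := by ring
  have hsum : Trip.card * M ^ n ≤ 2 * M ^ 2 * ∑ f : V → Fin M, (Trip.filter (fun t => good f t)).card := by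
    have e : ∑ f : V → Fin M, (Trip.filter (fun t => good f t)).card = ∑ t ∈ Trip, (Finset.univ.filter (fun f => good f t)).card :=
      Finset.sum_card_bipartiteAbove_eq_sum_card_bipartiteBelow good
    rw [e, Finset.mul_sum]
    calc _ = ∑ t ∈ Trip, M ^ n := by simp
      _ ≤ _ := Finset.sum_le_sum hgood
  have hsumB : (∑ f : V → Fin M, (samp f ∩ H).card) * M = H.card * M ^ n := by
    have e : ∑ f : V → Fin M, (samp f ∩ H).card = ∑ b ∈ H, (fs M {b}).card := by
      have := Finset.sum_card_bipartiteAbove_eq_sum_card_bipartiteBelow (s := (Finset.univ : Finset (V → Fin M))) (t := H) (fun f b => b ∈ samp f)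
      convert this using 2 with f hf b hb
      · congr 1; ext u; simp [Finset.bipartiteAbove, and_comm]
      · simp [Finset.bipartiteBelow, fs]
    rw [e, Finset.sum_mul]
    calc _ = ∑ b ∈ H, M ^ n := by
          apply Finset.sum_congr rfl
          intro b _
          have := card_fs M ({b} : Finset V)
          simpa using this
      _ = _ := by simp
  have hex : ∃ f : V → Fin M, m ^ 2 * (samp f ∩ H).card < 8 * M * (Trip.filter (fun t => good f t)).card := by
    by_contra hcon
    push Not at hcon
    have hs := Finset.sum_le_sum (fun f (_ : f ∈ (Finset.univ : Finset (V → Fin M))) => hcon f)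
    rw [← Finset.mul_sum, ← Finset.mul_sum] at hs
    set Sg1 := ∑ f : V → Fin M, (Trip.filter (fun t => good f t)).card
    set Sg2 := ∑ f : V → Fin M, (samp f ∩ H).card
    have hN : 0 < M ^ n := Nat.pow_pos hMpos
    have hHp : 0 < H.card := Finset.card_pos.mpr hH
    have k1 : 8 * M * Sg1 * M ≤ m ^ 2 * (H.card * M ^ n) := by
      rw [← hsumB]
      calc _ ≤ m ^ 2 * Sg2 * M := Nat.mul_le_mul_right _ hs
        _ = _ := by ring
    have k2 : 4 * (Trip.card * M ^ n) ≤ 8 * M * Sg1 * M := by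
      calc _ ≤ 4 * (2 * M ^ 2 * Sg1) := by omega
        _ = _ := by ring
    have k3 : (H.card * m ^ 2) * M ^ n ≤ (2 * Trip.card) * M ^ n := Nat.mul_le_mul_right _ hTrip
    have k4 : 0 < (H.card * m ^ 2) * M ^ n := by positivity
    nlinarith
  obtain ⟨f, hf⟩ := hex
  refine ⟨samp f, Trip.filter (fun t => good f t), hf, ?_⟩
  rintro ⟨a, b, b'⟩ ht
  simp only [Trip, Wf, good, Finset.mem_filter, Finset.mem_univ, true_and, fs] at ht
  obtain ⟨⟨hb, ha, hb', hg', hbb', hnadj, hN⟩, hfs, hdis, hc⟩ := ht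
  exact ⟨hb, hb', hfs (by simp), hfs (by simp), ha, hg'.1, hbb', hnadj, hN, hdis, hc⟩

lemma structure_lem (G : SimpleGraph V) (z x d : ℕ) (hz : 200 ≤ z) (hx : 1 ≤ x) (hd : d = z ^ 14 * x)
    (hE : ∀ S : Finset V, E2 G S ≤ 4 * d * S.card) (hn : d * Fintype.card V ≤ E2 G Finset.univ)
    (hV : 0 < Fintype.card V)
    (hD : ∀ S Y : Finset V, S.card ≤ z * d → (∀ b ∈ Y, x ≤ (nb G b ∩ S).card) → Y.card ≤ x) :
    ∃ (B I : Finset V) (p q : V → V), Indep G B ∧ Indep G I ∧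
      (∀ a ∈ I, p a ∈ B ∧ q a ∈ B ∧ p a ≠ q a ∧ nb G a ∩ B = {p a, q a}) ∧
      (∀ a ∈ I, ∀ a' ∈ I, p a = p a' → q a = q a' → a = a') ∧ z * B.card < I.card := by
  obtain ⟨out, ho1, ho2, ho3⟩ := exists_out G (4 * d) hE
  set A : Finset V := Finset.univ.filter (fun v => (nb G v).card ≤ z * d) with hA
  have hcg := count_gam G z x d hz hx hd hE hn hV hD A hA
  obtain ⟨A', hA'A, H, -, hH, hp1, hp2⟩ := prune (Gam G x) (z ^ 13 * x) _ A Finset.univ rfl hcg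
  have hch : ∀ b, ∃ N : Finset V, b ∈ H → N ⊆ A'.filter (fun a => Gam G x a b) ∧ N.card = z ^ 13 * x := by
    intro b
    by_cases hb : b ∈ H
    · obtain ⟨N, hN, hc⟩ := Finset.exists_subset_card_eq (hp2 b hb)
      exact ⟨N, fun _ => ⟨hN, hc⟩⟩
    · exact ⟨∅, fun h => absurd h hb⟩
  choose N' hN' using hch
  obtain ⟨B0, TG, hcount, hTG⟩ := exists_sample G z x d hz hx hd hD out ho1 ho2 A A' H
    (fun a ha => (Finset.mem_filter.mp ha).2) hA'A hH hp1 N' (fun b hb => (hN' b hb).1) (fun b hb => (hN' b hb).2)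
  set B : Finset V := (B0 ∩ H).filter (fun b => Disjoint (out b) B0) with hB
  have hBsub : B ⊆ B0 := (Finset.filter_subset _ _).trans Finset.inter_subset_left
  have hBi : Indep G B := by
    intro u hu v hv huv
    rcases ho3 u v huv with h | h
    · exact Finset.disjoint_left.mp (Finset.mem_filter.mp hu).2 h (hBsub hv)
    · exact Finset.disjoint_left.mp (Finset.mem_filter.mp hv).2 h (hBsub hu)
  have hself : ∀ b, b ∉ out b := fun b hb => G.irrefl (mem_nb.mp (ho1 b hb))
  have hfacts : ∀ t ∈ TG, t.2.1 ∈ B ∧ t.2.2 ∈ B ∧ t.2.1 ≠ t.2.2 ∧ nb G t.1 ∩ B0 = {t.2.1, t.2.2} ∧ t.1 ∈ A' ∧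
      t.1 ∈ N' t.2.1 ∧ G.Adj t.1 t.2.2 ∧ (N' t.2.1 ∩ nb G t.2.2).card < x ∧
      ((out t.1 ∩ A).filter (fun y => 2 ≤ (nb G y ∩ B0).card)).card ≤ z * x := by
    rintro ⟨a, b, b'⟩ ht
    obtain ⟨hb, hb', hb0, hb0', haN, hadj, hne, hnadj, hN, hdis, hc⟩ := hTG _ ht
    dsimp only at *
    have haf := Finset.mem_filter.mp ((hN' b hb).1 haN)
    have hdis' : ∀ y ∈ B0, y ∈ nb G a ∪ out b ∪ out b' → y = b ∨ y = b' := by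
      intro y hy hy2
      by_contra hcon
      push Not at hcon
      refine Finset.disjoint_left.mp hdis (Finset.mem_sdiff.mpr ⟨hy2, ?_⟩) hy
      simp [hcon]
    refine ⟨?_, ?_, hne, ?_, haf.1, haN, hadj, hN, hc⟩
    · refine Finset.mem_filter.mpr ⟨Finset.mem_inter.mpr ⟨hb0, hb⟩, ?_⟩
      rw [Finset.disjoint_left]
      intro y hy hy0
      rcases hdis' y hy0 (by simp [hy]) with rfl | rfl
      · exact hself _ hy
      · exact hnadj (mem_nb.mp (ho1 _ hy))
    · refine Finset.mem_filter.mpr ⟨Finset.mem_inter.mpr ⟨hb0', hb'⟩, ?_⟩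
      rw [Finset.disjoint_left]
      intro y hy hy0
      rcases hdis' y hy0 (by simp [hy]) with rfl | rfl
      · exact hnadj (mem_nb.mp (ho1 _ hy)).symm
      · exact hself _ hy
    · ext y
      simp only [Finset.mem_inter, Finset.mem_insert, Finset.mem_singleton]
      constructor
      · rintro ⟨h1, h2⟩
        exact hdis' y h2 (by simp [h1])
      · rintro (rfl | rfl)
        · exact ⟨mem_nb.mpr haf.2.1, hb0⟩
        · exact ⟨mem_nb.mpr hadj, hb0'⟩
  set S : Finset V := TG.image Prod.fst with hS
  have hTS : TG.card ≤ 4 * S.card := by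
    apply Finset.card_le_mul_card_image
    intro a ha
    obtain ⟨t, ht, rfl⟩ := Finset.mem_image.mp ha
    have hsub : (TG.filter (fun s => s.1 = t.1)) ⊆ ({t.1} : Finset V) ×ˢ (({t.2.1, t.2.2} : Finset V) ×ˢ ({t.2.1, t.2.2} : Finset V)) := by
      intro s hs
      obtain ⟨hs, hst⟩ := Finset.mem_filter.mp hs
      have f1 := (hfacts s hs).2.2.2.1
      have f2 := (hfacts t ht).2.2.2.1
      rw [hst, f2] at f1
      simp only [Finset.mem_product, Finset.mem_singleton]
      refine ⟨hst, ?_, ?_⟩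
      · rw [f1]; simp
      · rw [f1]; simp
    refine (Finset.card_le_card hsub).trans ?_
    rw [Finset.card_product, Finset.card_product, Finset.card_singleton]
    have : ({t.2.1, t.2.2} : Finset V).card ≤ 2 := Finset.card_le_two
    nlinarith
  have hSch : ∀ a, ∃ b : V × V, a ∈ S → (a, b) ∈ TG := by
    intro a
    by_cases ha : a ∈ S
    · obtain ⟨t, ht, rfl⟩ := Finset.mem_image.mp ha
      exact ⟨t.2, fun _ => ht⟩
    · exact ⟨(a, a), fun h => absurd h ha⟩
  choose pq hpq using hSch
  obtain ⟨I, hIS, hI, hIc⟩ := indep_of_out (fun a a' : V => a' ∈ out a ∨ ((pq a').1 = (pq a).1 ∧ (pq a').2 = (pq a).2))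
    (z * x + x) _ S rfl (by
      intro a ha
      have fa := hfacts _ (hpq a ha)
      dsimp only at fa
      obtain ⟨-, -, -, -, -, -, -, fx, fz⟩ := fa
      have hsub : (S.filter (fun a' => a' ∈ out a ∨ ((pq a').1 = (pq a).1 ∧ (pq a').2 = (pq a).2))) ⊆
          ((out a ∩ A).filter (fun y => 2 ≤ (nb G y ∩ B0).card)) ∪ (N' (pq a).1 ∩ nb G (pq a).2) := by
        intro a' ha'
        obtain ⟨h1, h2⟩ := Finset.mem_filter.mp ha'
        have fa' := hfacts _ (hpq a' h1)
        dsimp only at fa'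
        rw [Finset.mem_union]
        rcases h2 with h2 | ⟨h2, h3⟩
        · left
          refine Finset.mem_filter.mpr ⟨Finset.mem_inter.mpr ⟨h2, hA'A fa'.2.2.2.2.1⟩, ?_⟩
          rw [fa'.2.2.2.1, Finset.card_pair fa'.2.2.1]
        · right
          rw [← h2, ← h3]
          exact Finset.mem_inter.mpr ⟨fa'.2.2.2.2.2.1, mem_nb.mpr fa'.2.2.2.2.2.2.1.symm⟩
      have := Finset.card_le_card hsub
      have := Finset.card_union_le ((out a ∩ A).filter (fun y => 2 ≤ (nb G y ∩ B0).card)) (N' (pq a).1 ∩ nb G (pq a).2)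
      have key : (S.filter (fun a' => a' ∈ out a ∨ ((pq a').1 = (pq a).1 ∧ (pq a').2 = (pq a).2))).card ≤ z * x + x := by omega
      convert key)
  refine ⟨B, I, fun a => (pq a).1, fun a => (pq a).2, hBi, ?_, ?_, ?_, ?_⟩
  · intro u hu v hv huv
    rcases ho3 u v huv with h | h
    · exact hI u hu v hv huv.ne (Or.inl h)
    · exact hI v hv u hu huv.ne' (Or.inl h)
  · intro a ha
    have fa := hfacts _ (hpq a (hIS ha))
    dsimp only at fa
    refine ⟨fa.1, fa.2.1, fa.2.2.1, ?_⟩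
    apply Finset.Subset.antisymm
    · rw [← fa.2.2.2.1]; exact Finset.inter_subset_inter_left hBsub
    · intro y hy
      have hy' := hy
      rw [← fa.2.2.2.1] at hy'
      refine Finset.mem_inter.mpr ⟨(Finset.mem_inter.mp hy').1, ?_⟩
      simp only [Finset.mem_insert, Finset.mem_singleton] at hy
      rcases hy with rfl | rfl
      · exact fa.1
      · exact fa.2.1
  · intro a ha a' ha' h1 h2
    by_contra hne
    exact hI a ha a' ha' hne (Or.inr ⟨h1.symm, h2.symm⟩)
  · have hBc : B.card ≤ (B0 ∩ H).card := Finset.card_le_card (Finset.filter_subset _ _)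
    have k1 : (z ^ 13 * x) ^ 2 * B.card < 8 * (z ^ 22 * x) * (4 * ((2 * (z * x + x) + 1) * I.card)) := by
      refine lt_of_le_of_lt (Nat.mul_le_mul_left _ hBc) (lt_of_lt_of_le hcount ?_)
      apply Nat.mul_le_mul_left
      exact hTS.trans (Nat.mul_le_mul_left _ hIc)
    have k2 : 2 * (z * x + x) + 1 ≤ 5 * (z * x) := by nlinarith
    have k3 : 8 * (z ^ 22 * x) * (4 * ((2 * (z * x + x) + 1) * I.card)) ≤ (z ^ 13 * x) ^ 2 * I.card := by
      calc _ ≤ 8 * (z ^ 22 * x) * (4 * ((5 * (z * x)) * I.card)) := by gcongr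
        _ = 160 * (z ^ 23 * x ^ 2 * I.card) := by ring
        _ ≤ z ^ 2 * (z ^ 23 * x ^ 2 * I.card) := by
          apply Nat.mul_le_mul_right; nlinarith
        _ = z ^ 25 * (x ^ 2 * I.card) := by ring
        _ ≤ _ := le_refl _
        _ ≤ z ^ 26 * (x ^ 2 * I.card) := by
          apply Nat.mul_le_mul_right
          exact Nat.pow_le_pow_right (by omega) (by norm_num)
        _ = _ := by ring
    have k4 : 8 * (z ^ 22 * x) * (4 * ((2 * (z * x + x) + 1) * I.card)) * z ≤ (z ^ 13 * x) ^ 2 * I.card := by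
      calc _ ≤ 8 * (z ^ 22 * x) * (4 * ((5 * (z * x)) * I.card)) * z := by gcongr
        _ = 160 * (z ^ 24 * x ^ 2 * I.card) := by ring
        _ ≤ z ^ 2 * (z ^ 24 * x ^ 2 * I.card) := by
          apply Nat.mul_le_mul_right; nlinarith
        _ = _ := by ring
    have k5 : (z ^ 13 * x) ^ 2 * (z * B.card) < (z ^ 13 * x) ^ 2 * I.card := by
      calc _ = (z ^ 13 * x) ^ 2 * B.card * z := by ring
        _ < _ := Nat.mul_lt_mul_of_pos_right k1 (by omega)
        _ ≤ _ := k4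
    exact Nat.lt_of_mul_lt_mul_left k5

/-- `a`, then the list `l`, then `b`, is a walk in `F`. -/
def PathAdj (F : SimpleGraph V) : V → List V → V → Prop
  | a, [], b => F.Adj a b
  | a, x :: l, b => F.Adj a x ∧ PathAdj F x l b

lemma PathAdj.append {F : SimpleGraph V} {l l' : List V} {a x b : V} (h : PathAdj F a l x) (h' : PathAdj F x l' b) :
    PathAdj F a (l ++ x :: l') b := by
  induction l generalizing a with
  | nil => exact ⟨h, h'⟩
  | cons y l ih => exact ⟨h.1, ih h.2⟩

lemma PathAdj.rev {F : SimpleGraph V} {l : List V} {a b : V} (h : PathAdj F a l b) : PathAdj F b l.reverse a := by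
  induction l generalizing a with
  | nil => exact h.symm
  | cons y l ih =>
    rw [List.reverse_cons]
    exact PathAdj.append (ih h.2) h.1.symm

lemma PathAdj.suffix {F : SimpleGraph V} {s t : List V} {a x b : V} (h : PathAdj F a (s ++ x :: t) b) : PathAdj F x t b := by
  induction s generalizing a with
  | nil => exact h.2
  | cons y s ih => exact ih h.2

lemma PathAdj.shorten {F : SimpleGraph V} {l : List V} {a b : V} (h : PathAdj F a l b) :
    ∃ l' : List V, l'.Nodup ∧ (∀ y ∈ l', y ∈ l) ∧ PathAdj F a l' b := by
  induction l generalizing a with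
  | nil => exact ⟨[], by simp, by simp, h⟩
  | cons x l ih =>
    obtain ⟨l', h1, h2, h3⟩ := ih h.2
    by_cases hx : x ∈ l'
    · obtain ⟨s, t, rfl⟩ := List.append_of_mem hx
      refine ⟨x :: t, ?_, ?_, h.1, h3.suffix⟩
      · exact h1.sublist (List.sublist_append_right _ _)
      · intro y hy
        simp only [List.mem_cons] at hy ⊢
        rcases hy with rfl | hy
        · left; rfl
        · right; exact h2 y (by simp [hy])
    · refine ⟨x :: l', List.nodup_cons.mpr ⟨hx, h1⟩, ?_, h.1, h3⟩
      intro y hy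
      simp only [List.mem_cons] at hy ⊢
      rcases hy with rfl | hy
      · left; rfl
      · right; exact h2 y hy

lemma E2_erase (F : SimpleGraph V) (T : Finset V) (y : V) (hy : y ∈ T) :
    E2 F T = E2 F (T.erase y) + 2 * (nb F y ∩ T).card := by
  unfold E2
  rw [← Finset.add_sum_erase _ _ hy]
  have h1 : ∀ x ∈ T.erase y, (nb F x ∩ T).card = (nb F x ∩ T.erase y).card + if x ∈ nb F y then 1 else 0 := by
    intro x hx
    by_cases hxy : x ∈ nb F y
    · have hyx : y ∈ nb F x ∩ T := Finset.mem_inter.mpr ⟨mem_nb.mpr (mem_nb.mp hxy).symm, hy⟩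
      rw [if_pos hxy, Finset.inter_erase, Finset.card_erase_add_one]
      exact hyx
    · have hyx : y ∉ nb F x ∩ T := fun h => hxy (mem_nb.mpr (mem_nb.mp (Finset.mem_inter.mp h).1).symm)
      rw [if_neg hxy, Finset.inter_erase, Finset.erase_eq_of_notMem hyx, add_zero]
  rw [Finset.sum_congr rfl h1, Finset.sum_add_distrib, ← Finset.card_filter]
  have h2 : (T.erase y).filter (fun x => x ∈ nb F y) = nb F y ∩ T := by
    ext x
    simp only [Finset.mem_filter, Finset.mem_erase, Finset.mem_inter]
    constructor
    · tauto
    · rintro ⟨h1, h2⟩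
      refine ⟨⟨?_, h2⟩, h1⟩
      rintro rfl
      exact F.irrefl (mem_nb.mp h1)
  rw [h2]; ring

/-- rooted connectivity -/
def RC (F : SimpleGraph V) (ρ : V) (U : Finset V) : Prop :=
  ρ ∈ U ∧ ∀ a ∈ U, a = ρ ∨ ∃ l : List V, (∀ y ∈ l, y ∈ U) ∧ PathAdj F a l ρ

lemma RC.to {F : SimpleGraph V} {ρ : V} {U : Finset V} (h : RC F ρ U) {u a : V} (ha : a ∈ U) (hu : F.Adj u a) :
    ∃ l : List V, (∀ y ∈ l, y ∈ U) ∧ PathAdj F u l ρ := by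
  rcases h.2 a ha with rfl | ⟨l, h1, h2⟩
  · exact ⟨[], by simp, hu⟩
  · refine ⟨a :: l, ?_, hu, h2⟩
    intro y hy
    rcases List.mem_cons.mp hy with rfl | hy
    · exact ha
    · exact h1 y hy

lemma RC.link {F : SimpleGraph V} {ρ : V} {U : Finset V} (h : RC F ρ U) {u a v b : V} (ha : a ∈ U) (hu : F.Adj u a)
    (hb : b ∈ U) (hv : F.Adj v b) :
    ∃ l : List V, l.Nodup ∧ (∀ y ∈ l, y ∈ U) ∧ PathAdj F u l v := by
  obtain ⟨l, h1, h2⟩ := h.to ha hu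
  obtain ⟨l', h1', h2'⟩ := h.to hb hv
  obtain ⟨k, k1, k2, k3⟩ := (h2.append h2'.rev).shorten
  refine ⟨k, k1, ?_, k3⟩
  intro y hy
  have := k2 y hy
  simp only [List.mem_append, List.mem_cons, List.mem_reverse] at this
  rcases this with h3 | rfl | h3
  · exact h1 y h3
  · exact h.1
  · exact h1' y h3

lemma RC.insert {F : SimpleGraph V} {ρ : V} {U : Finset V} (h : RC F ρ U) {u a : V} (ha : a ∈ U) (hu : F.Adj u a) :
    RC F ρ (insert u U) := by
  refine ⟨Finset.mem_insert_of_mem h.1, ?_⟩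
  intro b hb
  rcases Finset.mem_insert.mp hb with rfl | hb
  · right
    obtain ⟨l, h1, h2⟩ := h.to ha hu
    exact ⟨l, fun y hy => Finset.mem_insert_of_mem (h1 y hy), h2⟩
  · rcases h.2 b hb with h3 | ⟨l, h1, h2⟩
    · left; exact h3
    · right; exact ⟨l, fun y hy => Finset.mem_insert_of_mem (h1 y hy), h2⟩

/-- outer neighbourhood of `U` in `S` -/
noncomputable def NS (F : SimpleGraph V) (S U : Finset V) : Finset V := (S \ U).filter (fun y => ∃ a ∈ U, F.Adj y a)

lemma mader_step (F : SimpleGraph V) (c : ℕ) (hc : 1 ≤ c) : ∀ (n : ℕ) (S : Finset V), S.card = n → S.Nonempty →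
    2 * c * S.card ≤ E2 F S → ∃ U N : Finset V, N ⊆ S ∧ U ⊆ S ∧ Disjoint U N ∧ N.Nonempty ∧ c * N.card ≤ E2 F N ∧
      ∀ u ∈ N, ∀ v ∈ N, ∃ l : List V, l.Nodup ∧ (∀ y ∈ l, y ∈ U) ∧ PathAdj F u l v := by
  intro n
  induction n using Nat.strong_induction_on with
  | _ n ih =>
    intro S hSn hS hE
    let P : Finset V → Prop := fun U => (∃ ρ, RC F ρ U) ∧ 2 * c * ((S \ U).card + 1) ≤ E2 F (S \ U) + 2 * (NS F S U).card
    let fam := S.powerset.filter P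
    have hfam : fam.Nonempty := by
      obtain ⟨v, hv⟩ := hS
      refine ⟨{v}, Finset.mem_filter.mpr ⟨by simpa using hv, ⟨v, by simp, by simp⟩, ?_⟩⟩
      have e1 : S \ {v} = S.erase v := by ext; simp [and_comm]
      have e2 : NS F S {v} = nb F v ∩ S := by
        ext y
        simp only [NS, Finset.mem_filter, Finset.mem_sdiff, Finset.mem_singleton, exists_eq_left, Finset.mem_inter, mem_nb]
        constructor
        · rintro ⟨⟨h1, h2⟩, h3⟩; exact ⟨h3.symm, h1⟩
        · rintro ⟨h1, h2⟩; exact ⟨⟨h2, h1.ne'⟩, h1.symm⟩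
      rw [e1, e2, Finset.card_erase_add_one hv, ← E2_erase F S v hv]
      exact hE
    obtain ⟨U, hU, hmax⟩ := Finset.exists_max_image fam Finset.card hfam
    obtain ⟨hUS, ⟨ρ, hρ⟩, hUE⟩ := Finset.mem_filter.mp hU
    rw [Finset.mem_powerset] at hUS
    rcases (NS F S U).eq_empty_or_nonempty with hemp | hne
    · rw [hemp, Finset.card_empty] at hUE
      have hne' : (S \ U).Nonempty := by
        rw [Finset.nonempty_iff_ne_empty]
        intro h
        rw [h] at hUE
        simp [E2] at hUE
        omega
      have hlt : (S \ U).card < n := by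
        rw [← hSn]
        apply Finset.card_lt_card
        refine ⟨Finset.sdiff_subset, fun h => ?_⟩
        exact (Finset.mem_sdiff.mp (h (hUS hρ.1))).2 hρ.1
      obtain ⟨U', N', h1, h2, h3⟩ := ih _ hlt (S \ U) rfl hne' (by nlinarith)
      exact ⟨U', N', h1.trans Finset.sdiff_subset, h2.trans Finset.sdiff_subset, h3⟩
    · refine ⟨U, NS F S U, (Finset.filter_subset _ _).trans Finset.sdiff_subset, hUS, ?_, hne, ?_, ?_⟩
      · rw [Finset.disjoint_left]
        intro y hy hy'
        exact (Finset.mem_sdiff.mp (Finset.mem_filter.mp hy').1).2 hy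
      · have hdeg : ∀ y ∈ NS F S U, c ≤ (nb F y ∩ NS F S U).card := by
          intro y hy
          obtain ⟨hySU, a, ha, hya⟩ := Finset.mem_filter.mp hy
          have hyU := (Finset.mem_sdiff.mp hySU).2
          have hyS := (Finset.mem_sdiff.mp hySU).1
          have hnot : ¬ P (insert y U) := by
            intro hP
            have := hmax (insert y U) (Finset.mem_filter.mpr ⟨by
              rw [Finset.mem_powerset]; exact Finset.insert_subset hyS hUS, hP⟩)
            rw [Finset.card_insert_of_notMem hyU] at this
            omega
          have e1 : S \ (insert y U) = (S \ U).erase y := by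
            ext w; simp only [Finset.mem_sdiff, Finset.mem_insert, Finset.mem_erase]; tauto
          have hlt : E2 F ((S \ U).erase y) + 2 * (NS F S (insert y U)).card < 2 * c * (S \ U).card := by
            by_contra hcon
            push Not at hcon
            apply hnot
            refine ⟨⟨ρ, hρ.insert ha hya⟩, ?_⟩
            rw [e1, Finset.card_erase_add_one hySU]
            exact hcon
          have hsub : (NS F S U).erase y ∪ ((nb F y ∩ (S \ U)) \ NS F S U) ⊆ NS F S (insert y U) := by
            intro w hw
            simp only [NS, Finset.mem_filter, e1]
            rcases Finset.mem_union.mp hw with hw | hw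
            · obtain ⟨h1, h2⟩ := Finset.mem_erase.mp hw
              obtain ⟨h3, b, hb, hwb⟩ := Finset.mem_filter.mp h2
              exact ⟨Finset.mem_erase.mpr ⟨h1, h3⟩, b, Finset.mem_insert_of_mem hb, hwb⟩
            · obtain ⟨h1, h2⟩ := Finset.mem_sdiff.mp hw
              obtain ⟨h3, h4⟩ := Finset.mem_inter.mp h1
              have hyw := mem_nb.mp h3
              exact ⟨Finset.mem_erase.mpr ⟨hyw.ne', h4⟩, y, Finset.mem_insert_self _ _, hyw.symm⟩
          have hdisj : Disjoint ((NS F S U).erase y) ((nb F y ∩ (S \ U)) \ NS F S U) := by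
            rw [Finset.disjoint_left]
            intro w hw hw'
            exact (Finset.mem_sdiff.mp hw').2 (Finset.mem_erase.mp hw).2
          have c1 := Finset.card_le_card hsub
          rw [Finset.card_union_of_disjoint hdisj] at c1
          have c2 := Finset.card_erase_add_one hy
          have c3 := Finset.card_inter_add_card_sdiff (nb F y ∩ (S \ U)) (NS F S U)
          have e2 : nb F y ∩ (S \ U) ∩ NS F S U = nb F y ∩ NS F S U := by
            ext w
            simp only [Finset.mem_inter, NS, Finset.mem_filter]
            tauto
          rw [e2] at c3
          have c4 := E2_erase F (S \ U) y hySU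
          rw [mul_add] at hUE
          omega
        calc c * (NS F S U).card = ∑ y ∈ NS F S U, c := by simp [mul_comm]
          _ ≤ _ := Finset.sum_le_sum hdeg
      · intro u hu v hv
        obtain ⟨-, a, ha, hua⟩ := Finset.mem_filter.mp hu
        obtain ⟨-, b, hb, hvb⟩ := Finset.mem_filter.mp hv
        exact hρ.link ha hua hb hvb

lemma mader {W : Type} [Fintype W] [Nonempty W] (F : SimpleGraph V) (L : Finset (W × W)) : ∀ (S : Finset V), S.Nonempty →
    Fintype.card W * 2 ^ L.card * S.card ≤ E2 F S →
    ∃ (φ : W → V) (P : W × W → List V), Function.Injective φ ∧ (∀ w, φ w ∈ S) ∧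
      (∀ e ∈ L, PathAdj F (φ e.1) (P e) (φ e.2) ∧ (P e).Nodup ∧ ∀ y ∈ P e, y ∈ S ∧ ∀ w, y ≠ φ w) ∧
      (∀ e ∈ L, ∀ e' ∈ L, e ≠ e' → ∀ y ∈ P e, y ∉ P e') := by
  induction L using Finset.induction_on with
  | empty =>
    intro S hS hE
    have h1 : E2 F S ≤ S.card * S.card := by
      calc E2 F S ≤ ∑ x ∈ S, S.card := Finset.sum_le_sum (fun x _ => Finset.card_le_card Finset.inter_subset_right)
        _ = _ := by simp
    have hpos := Finset.card_pos.mpr hS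
    simp only [Finset.card_empty, pow_zero, mul_one] at hE
    have h2 : Fintype.card W ≤ Fintype.card S := by
      rw [Fintype.card_coe]
      exact Nat.le_of_mul_le_mul_right (hE.trans h1) hpos
    obtain ⟨f⟩ := Function.Embedding.nonempty_of_card_le h2
    exact ⟨fun w => (f w : V), fun _ => [], fun a b h => f.injective (Subtype.ext h), fun w => (f w).2, by simp, by simp⟩
  | insert e L he ih =>
    intro S hS hE
    rw [Finset.card_insert_of_notMem he, pow_succ] at hE
    obtain ⟨U, N, hN, hU, hdis, hNne, hNE, hlink⟩ := mader_step F (Fintype.card W * 2 ^ L.card)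
      (Nat.mul_pos Fintype.card_pos (by positivity)) _ S rfl hS (by
        calc _ = Fintype.card W * (2 ^ L.card * 2) * S.card := by ring
          _ ≤ _ := hE)
    obtain ⟨φ, P, h1, h2, h3, h4⟩ := ih N hNne hNE
    obtain ⟨l, l1, l2, l3⟩ := hlink (φ e.1) (h2 _) (φ e.2) (h2 _)
    have hPe : ∀ e' ∈ L, Function.update P e l e' = P e' := by
      intro e' he'
      apply Function.update_of_ne
      rintro rfl
      exact he he'
    refine ⟨φ, Function.update P e l, h1, fun w => hN (h2 w), ?_, ?_⟩
    · intro e' he'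
      rcases Finset.mem_insert.mp he' with rfl | he'
      · rw [Function.update_self]
        refine ⟨l3, l1, fun y hy => ⟨hU (l2 y hy), ?_⟩⟩
        rintro w rfl
        exact Finset.disjoint_left.mp hdis (l2 _ hy) (h2 w)
      · rw [hPe e' he']
        obtain ⟨g1, g2, g3⟩ := h3 e' he'
        exact ⟨g1, g2, fun y hy => ⟨hN (g3 y hy).1, (g3 y hy).2⟩⟩
    · intro e1 he1 e2 he2 hne y hy hy2
      rcases Finset.mem_insert.mp he1 with rfl | hf1 <;> rcases Finset.mem_insert.mp he2 with rfl | hf2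
      · exact hne rfl
      · rw [Function.update_self] at hy
        rw [hPe e2 hf2] at hy2
        exact Finset.disjoint_left.mp hdis (l2 _ hy) ((h3 e2 hf2).2.2 y hy2).1
      · rw [Function.update_self] at hy2
        rw [hPe e1 hf1] at hy
        exact Finset.disjoint_left.mp hdis (l2 _ hy2) ((h3 e1 hf1).2.2 y hy).1
      · rw [hPe e1 hf1] at hy
        rw [hPe e2 hf2] at hy2
        exact h4 e1 hf1 e2 hf2 hne y hy hy2

lemma es_ss {U : Type} (S : SimpleGraph U) (a b u v : U) :
    (edgeSubdiv S a b).Adj (some u) (some v) ↔ S.Adj u v ∧ s(u, v) ≠ s(a, b) := by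
  simp only [edgeSubdiv, SimpleGraph.fromRel_adj, ne_eq, Option.some.injEq, Sym2.eq_iff]
  constructor
  · rintro ⟨hne, h | h⟩
    · rcases h with ⟨x, y, rfl, rfl, h1, h2⟩ | ⟨h, -⟩
      · exact ⟨h1, h2⟩
      · cases h
    · rcases h with ⟨x, y, rfl, rfl, h1, h2⟩ | ⟨h, -⟩
      · refine ⟨h1.symm, ?_⟩
        rintro (⟨rfl, rfl⟩ | ⟨rfl, rfl⟩)
        · exact h2 (Or.inr ⟨rfl, rfl⟩)
        · exact h2 (Or.inl ⟨rfl, rfl⟩)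
      · cases h
  · rintro ⟨h1, h2⟩
    exact ⟨h1.ne, Or.inl (Or.inl ⟨u, v, rfl, rfl, h1, h2⟩)⟩

lemma es_ns {U : Type} (S : SimpleGraph U) (a b v : U) :
    (edgeSubdiv S a b).Adj none (some v) ↔ v = a ∨ v = b := by
  simp [edgeSubdiv, SimpleGraph.fromRel_adj]

lemma es_sn {U : Type} (S : SimpleGraph U) (a b v : U) :
    (edgeSubdiv S a b).Adj (some v) none ↔ v = a ∨ v = b := by
  rw [SimpleGraph.adj_comm, es_ns]

/-- the graph with edge set `E`, restricted to `s`, is a subdivision of `H` -/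
def SubOn {V W : Type} (H : SimpleGraph W) (s : Set V) (E : Set (Sym2 V)) : Prop :=
  ∃ (U : Type) (S : SimpleGraph U), IsSubdivision H S ∧ Nonempty ((SimpleGraph.fromEdgeSet E).induce s ≃g S)

/-- edges of `E` have their ends in `s` -/
def Supp {V : Type} (s : Set V) (E : Set (Sym2 V)) : Prop := ∀ e ∈ E, ∀ v ∈ e, v ∈ s

lemma subOn_step {V W : Type} {H : SimpleGraph W} {s : Set V} {E : Set (Sym2 V)} (h : SubOn H s E) (hs : Supp s E)
    {a b x : V} (hx : x ∉ s) (hab : a ≠ b) (he : s(a, b) ∈ E) :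
    SubOn H (insert x s) ((E \ {s(a, b)}) ∪ {s(a, x), s(x, b)}) := by
  obtain ⟨U, S, hS, ⟨f⟩⟩ := h
  have ha : a ∈ s := hs _ he a (by simp)
  have hb : b ∈ s := hs _ he b (by simp)
  have hax : a ≠ x := fun h => hx (h ▸ ha)
  have hbx : b ≠ x := fun h => hx (h ▸ hb)
  have hadj : S.Adj (f ⟨a, ha⟩) (f ⟨b, hb⟩) := by
    rw [f.map_adj_iff]
    simp [hab, he]
  refine ⟨Option U, edgeSubdiv S (f ⟨a, ha⟩) (f ⟨b, hb⟩), IsSubdivision.step _ _ _ _ hS hadj, ?_⟩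
  let g : Option s → (insert x s : Set V) := fun o => match o with
    | none => ⟨x, Set.mem_insert _ _⟩
    | some y => ⟨y.1, Set.mem_insert_of_mem _ y.2⟩
  have hg : Function.Bijective g := by
    constructor
    · rintro (_ | y) (_ | y') h
      · rfl
      · have : x = y'.1 := congrArg Subtype.val h
        exact absurd (this ▸ y'.2) hx
      · have : y.1 = x := congrArg Subtype.val h
        exact absurd (this ▸ y.2) hx
      · have : y.1 = y'.1 := congrArg (fun q : (insert x s : Set V) => q.1) h
        rw [Subtype.ext this]
    · rintro ⟨y, hy⟩
      rcases hy with rfl | hy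
      · exact ⟨none, rfl⟩
      · exact ⟨some ⟨y, hy⟩, rfl⟩
  let eq1 : Option s ≃ (insert x s : Set V) := Equiv.ofBijective g hg
  let eq2 : Option s ≃ Option U := Equiv.optionCongr f.toEquiv
  have hxE : ∀ y, s(x, y) ∉ E := fun y hy => hx (hs _ hy x (by simp))
  have hxE' : ∀ y, s(y, x) ∉ E := fun y hy => hx (hs _ hy x (by simp))
  have key : ∀ o o' : Option s, ((SimpleGraph.fromEdgeSet ((E \ {s(a, b)}) ∪ {s(a, x), s(x, b)})).induce (insert x s)).Adj (g o) (g o') ↔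
      (edgeSubdiv S (f ⟨a, ha⟩) (f ⟨b, hb⟩)).Adj (eq2 o) (eq2 o') := by
    have hns : ∀ y : s, ((SimpleGraph.fromEdgeSet ((E \ {s(a, b)}) ∪ {s(a, x), s(x, b)})).induce (insert x s)).Adj (g none) (g (some y)) ↔
      (y.1 = a ∨ y.1 = b) := by
      rintro ⟨y, hy⟩
      have hyx : y ≠ x := fun h => hx (h ▸ hy)
      simp only [SimpleGraph.comap_adj, Function.Embedding.subtype_apply, SimpleGraph.fromEdgeSet_adj, g,
        Set.mem_union, Set.mem_sdiff, Set.mem_insert_iff, Set.mem_singleton_iff, hxE, false_and, false_or, Sym2.eq_iff]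
      constructor
      · rintro ⟨h, -⟩
        rcases h with (⟨h, -⟩ | ⟨-, h⟩) | (⟨-, h⟩ | ⟨h, -⟩)
        · exact absurd h.symm hax
        · exact Or.inl h
        · exact Or.inr h
        · exact absurd h.symm hbx
      · rintro (rfl | rfl)
        · exact ⟨Or.inl (Or.inr ⟨trivial, rfl⟩), hyx.symm⟩
        · exact ⟨Or.inr (Or.inl ⟨trivial, rfl⟩), hyx.symm⟩
    have hfe : ∀ (y : s) (c : V) (hc : c ∈ s), f y = f ⟨c, hc⟩ ↔ y.1 = c := by
      intro y c hc
      rw [f.injective.eq_iff, Subtype.ext_iff]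
    rintro (_ | y) (_ | y')
    · simp
    · rw [hns]
      change _ ↔ (edgeSubdiv S (f ⟨a, ha⟩) (f ⟨b, hb⟩)).Adj none (some (f y'))
      rw [es_ns, hfe, hfe]
    · rw [SimpleGraph.adj_comm, hns]
      change _ ↔ (edgeSubdiv S (f ⟨a, ha⟩) (f ⟨b, hb⟩)).Adj (some (f y)) none
      rw [es_sn, hfe, hfe]
    · change _ ↔ (edgeSubdiv S (f ⟨a, ha⟩) (f ⟨b, hb⟩)).Adj (some (f y)) (some (f y'))
      rw [es_ss, f.map_adj_iff]
      obtain ⟨y, hy⟩ := y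
      obtain ⟨y', hy'⟩ := y'
      have hyx : y ≠ x := fun h => hx (h ▸ hy)
      have hyx' : y' ≠ x := fun h => hx (h ▸ hy')
      simp only [SimpleGraph.comap_adj, Function.Embedding.subtype_apply, SimpleGraph.fromEdgeSet_adj, g,
        Set.mem_union, Set.mem_sdiff, Set.mem_insert_iff, Set.mem_singleton_iff, Sym2.eq_iff, hfe, ne_eq]
      tauto
  refine ⟨⟨eq1.symm.trans eq2, ?_⟩⟩
  intro u v
  obtain ⟨o, rfl⟩ := hg.2 u
  obtain ⟨o', rfl⟩ := hg.2 v
  have e1 : ∀ o, eq1.symm (g o) = o := fun o => eq1.symm_apply_apply o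
  simp only [Equiv.trans_apply, e1]
  have hkey := key o o'
  exact Iff.symm hkey

/-- edges of a path given by its interior list -/
def pathE {V : Type} : V → List V → V → Set (Sym2 V)
  | a, [], b => {s(a, b)}
  | a, x :: l, b => {s(a, x)} ∪ pathE x l b

lemma pathE_sub (F : SimpleGraph V) {l : List V} {a b : V} (h : PathAdj F a l b) : pathE a l b ⊆ F.edgeSet := by
  induction l generalizing a with
  | nil => intro e he; rw [Set.mem_singleton_iff.mp he]; exact h
  | cons x l ih =>
    rintro e (he | he)
    · rw [Set.mem_singleton_iff.mp he]; exact h.1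
    · exact ih h.2 he

lemma subOn_path {V W : Type} {H : SimpleGraph W} {l : List V} {s : Set V} {E : Set (Sym2 V)} {a b : V} (h : SubOn H s E) (hs : Supp s E)
    (hl : l.Nodup) (hls : ∀ y ∈ l, y ∉ s) (hab : a ≠ b) (he : s(a, b) ∈ E) :
    SubOn H (s ∪ {y | y ∈ l}) ((E \ {s(a, b)}) ∪ pathE a l b) ∧ Supp (s ∪ {y | y ∈ l}) ((E \ {s(a, b)}) ∪ pathE a l b) := by
  induction l generalizing a s E with
  | nil =>
    have e1 : (E \ {s(a, b)}) ∪ pathE a [] b = E := by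
      simp only [pathE]
      rw [Set.sdiff_union_self, Set.union_eq_left]
      simpa using he
    have e2 : s ∪ {y | y ∈ ([] : List V)} = s := by simp
    rw [e1, e2]
    exact ⟨h, hs⟩
  | cons x l ih =>
    have hx : x ∉ s := hls x (by simp)
    have ha : a ∈ s := hs _ he a (by simp)
    have hb : b ∈ s := hs _ he b (by simp)
    have hax : a ≠ x := fun h => hx (h ▸ ha)
    have hbx : b ≠ x := fun h => hx (h ▸ hb)
    have h1 := subOn_step h hs hx hab he
    have hs1 : Supp (insert x s) ((E \ {s(a, b)}) ∪ {s(a, x), s(x, b)}) := by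
      intro e he v hv
      rcases he with ⟨he, -⟩ | he | he
      · exact Set.mem_insert_of_mem _ (hs e he v hv)
      · rw [he, Sym2.mem_iff] at hv
        rcases hv with rfl | rfl
        · exact Set.mem_insert_of_mem _ ha
        · exact Set.mem_insert _ _
      · rw [Set.mem_singleton_iff.mp he, Sym2.mem_iff] at hv
        rcases hv with rfl | rfl
        · exact Set.mem_insert _ _
        · exact Set.mem_insert_of_mem _ hb
    obtain ⟨hxl, hl'⟩ := List.nodup_cons.mp hl
    have h2 := ih (a := x) h1 hs1 hl' (by
      intro y hy hy'
      rcases hy' with rfl | hy'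
      · exact hxl hy
      · exact hls y (by simp [hy]) hy') hbx.symm (by simp)
    have e1 : (insert x s ∪ {y | y ∈ l}) = s ∪ {y | y ∈ x :: l} := by
      ext y; simp only [Set.mem_union, Set.mem_insert_iff, Set.mem_ofPred_eq, List.mem_cons]; tauto
    have e2 : (((E \ {s(a, b)}) ∪ {s(a, x), s(x, b)}) \ {s(x, b)}) ∪ pathE x l b = (E \ {s(a, b)}) ∪ pathE a (x :: l) b := by
      have hxb : s(x, b) ∉ E := fun h => hx (hs _ h x (by simp))
      have hne : s(a, x) ≠ s(x, b) := by
        rw [Ne, Sym2.eq_iff]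
        rintro (⟨h, -⟩ | ⟨h, -⟩)
        · exact hax h
        · exact hab h
      simp only [pathE]
      ext e
      simp only [Set.mem_union, Set.mem_sdiff, Set.mem_insert_iff, Set.mem_singleton_iff]
      constructor
      · rintro (⟨(h | h | h), h'⟩ | h)
        · exact Or.inl h
        · exact Or.inr (Or.inl h)
        · exact absurd h h'
        · exact Or.inr (Or.inr h)
      · rintro (h | h | h)
        · exact Or.inl ⟨Or.inl h, fun h' => hxb (h' ▸ h.1)⟩
        · exact Or.inl ⟨Or.inr (Or.inl h), fun h' => hne (h ▸ h')⟩
        · exact Or.inr h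
    rw [e1, e2] at h2
    exact h2

lemma subOn_all {W : Type} (H : SimpleGraph W) (F : SimpleGraph V) (L : Finset (W × W))
    (hL : ∀ u v, H.Adj u v ↔ (u, v) ∈ L ∨ (v, u) ∈ L) (hanti : ∀ u v, (u, v) ∈ L → (v, u) ∉ L)
    (S : Finset V) (φ : W → V) (P : W × W → List V) (hφ : Function.Injective φ) (hφS : ∀ w, φ w ∈ S)
    (hP : ∀ e ∈ L, PathAdj F (φ e.1) (P e) (φ e.2) ∧ (P e).Nodup ∧ ∀ y ∈ P e, y ∈ S ∧ ∀ w, y ≠ φ w)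
    (hP' : ∀ e ∈ L, ∀ e' ∈ L, e ≠ e' → ∀ y ∈ P e, y ∉ P e') :
    ∃ (s : Set V) (E : Set (Sym2 V)), SubOn H s E ∧ Supp s E ∧ E ⊆ F.edgeSet ∧ ∀ y ∈ s, y ∈ S := by
  have hinj : ∀ e ∈ L, ∀ e' ∈ L, s(φ e.1, φ e.2) = s(φ e'.1, φ e'.2) → e = e' := by
    rintro ⟨u, v⟩ he ⟨u', v'⟩ he' h
    rw [Sym2.eq_iff] at h
    rcases h with ⟨h1, h2⟩ | ⟨h1, h2⟩
    · exact Prod.ext (hφ h1) (hφ h2)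
    · have h1' : u = v' := hφ h1
      have h2' : v = u' := hφ h2
      subst h1' h2'
      exact absurd he' (hanti _ _ he)
  have main : ∀ L' : Finset (W × W), L' ⊆ L → ∃ (s : Set V) (E : Set (Sym2 V)), SubOn H s E ∧ Supp s E ∧
      (∀ e ∈ L \ L', s(φ e.1, φ e.2) ∈ E) ∧ (∀ e ∈ E, e ∈ F.edgeSet ∨ ∃ e' ∈ L \ L', e = s(φ e'.1, φ e'.2)) ∧
      (∀ y ∈ s, (∃ w, y = φ w) ∨ ∃ e ∈ L', y ∈ P e) := by
    intro L'
    induction L' using Finset.induction_on with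
    | empty =>
      intro _
      refine ⟨Set.range φ, {e | ∃ e' ∈ L, e = s(φ e'.1, φ e'.2)}, ⟨W, H, IsSubdivision.refl H, ⟨?_⟩⟩, ?_, ?_, ?_, ?_⟩
      · refine SimpleGraph.Iso.symm ⟨Equiv.ofInjective φ hφ, ?_⟩
        intro u v
        simp only [SimpleGraph.comap_adj, Function.Embedding.subtype_apply, SimpleGraph.fromEdgeSet_adj,
          Equiv.ofInjective_apply, Set.mem_ofPred_eq]
        rw [hL]
        constructor
        · rintro ⟨⟨⟨u', v'⟩, he, h⟩, -⟩
          rw [Sym2.eq_iff] at h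
          rcases h with ⟨h1, h2⟩ | ⟨h1, h2⟩
          · rw [hφ h1, hφ h2]; exact Or.inl he
          · rw [hφ h1, hφ h2]; exact Or.inr he
        · intro h
          have hne : φ u ≠ φ v := fun h' => ((hL u v).mpr h).ne (hφ h')
          rcases h with h | h
          · exact ⟨⟨_, h, rfl⟩, hne⟩
          · exact ⟨⟨_, h, Sym2.eq_swap⟩, hne⟩
      · rintro e ⟨e', -, rfl⟩ v hv
        rcases Sym2.mem_iff.mp hv with rfl | rfl
        · exact ⟨_, rfl⟩
        · exact ⟨_, rfl⟩
      · intro e he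
        exact ⟨e, (Finset.mem_sdiff.mp he).1, rfl⟩
      · rintro e ⟨e', he', rfl⟩
        exact Or.inr ⟨e', by simpa using he', rfl⟩
      · rintro y ⟨w, rfl⟩
        exact Or.inl ⟨w, rfl⟩
    | insert e L' he ih =>
      intro hsub
      have heL : e ∈ L := hsub (Finset.mem_insert_self _ _)
      obtain ⟨s, E, h1, h2, h3, h4, h5⟩ := ih ((Finset.subset_insert _ _).trans hsub)
      obtain ⟨p1, p2, p3⟩ := hP e heL
      have hne : φ e.1 ≠ φ e.2 := by
        intro h
        exact ((hL e.1 e.2).mpr (Or.inl heL)).ne (hφ h)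
      obtain ⟨q1, q2⟩ := subOn_path (l := P e) h1 h2 p2 (by
        intro y hy hys
        rcases h5 y hys with ⟨w, hw⟩ | ⟨e', he', hy'⟩
        · exact (p3 y hy).2 w hw
        · refine hP' e heL e' (hsub (Finset.mem_insert_of_mem he')) ?_ y hy hy'
          rintro rfl
          exact he he') hne (h3 e (Finset.mem_sdiff.mpr ⟨heL, he⟩))
      refine ⟨_, _, q1, q2, ?_, ?_, ?_⟩
      · intro e' he'
        obtain ⟨g1, g2⟩ := Finset.mem_sdiff.mp he'
        rw [Finset.mem_insert, not_or] at g2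
        left
        refine ⟨h3 e' (Finset.mem_sdiff.mpr ⟨g1, g2.2⟩), ?_⟩
        intro h
        exact g2.1 (hinj e' g1 e heL h)
      · rintro e' (⟨g1, g2⟩ | g)
        · rcases h4 e' g1 with h | ⟨e'', he'', rfl⟩
          · exact Or.inl h
          · right
            refine ⟨e'', ?_, rfl⟩
            obtain ⟨k1, k2⟩ := Finset.mem_sdiff.mp he''
            refine Finset.mem_sdiff.mpr ⟨k1, ?_⟩
            rw [Finset.mem_insert, not_or]
            refine ⟨?_, k2⟩
            rintro rfl
            exact g2 rfl
        · exact Or.inl (pathE_sub F p1 g)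
      · rintro y (hy | hy)
        · rcases h5 y hy with h | ⟨e', he', h⟩
          · exact Or.inl h
          · exact Or.inr ⟨e', Finset.mem_insert_of_mem he', h⟩
        · exact Or.inr ⟨e, Finset.mem_insert_self _ _, hy⟩
  obtain ⟨s, E, h1, h2, -, h4, h5⟩ := main L subset_rfl
  refine ⟨s, E, h1, h2, ?_, ?_⟩
  · intro e he
    rcases h4 e he with h | ⟨e', he', -⟩
    · exact h
    · simp at he'
  · intro y hy
    rcases h5 y hy with ⟨w, rfl⟩ | ⟨e, he, h⟩
    · exact hφS w
    · exact ((hP e he).2.2 y h).1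

lemma subOn_once {W : Type} (H : SimpleGraph W) (s : Set V) (E : Set (Sym2 V)) (h : SubOn H s E) (hs : Supp s E)
    (hd : ∀ e ∈ E, ¬ e.IsDiag) (c : Sym2 V → V) (hc : ∀ e ∈ E, c e ∉ s) (hci : ∀ e ∈ E, ∀ e' ∈ E, c e = c e' → e = e') :
    ∀ E' : Finset (Sym2 V), (E' : Set (Sym2 V)) ⊆ E →
      SubOn H (s ∪ {y | ∃ e ∈ E', y = c e}) ((E \ E') ∪ {f | ∃ e ∈ E', ∃ u ∈ e, f = s(u, c e)}) ∧
      Supp (s ∪ {y | ∃ e ∈ E', y = c e}) ((E \ E') ∪ {f | ∃ e ∈ E', ∃ u ∈ e, f = s(u, c e)}) := by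
  intro E'
  induction E' using Finset.induction_on with
  | empty => intro _; simpa using ⟨h, hs⟩
  | insert e E' he ih =>
    intro hsub
    have heE : e ∈ E := hsub (by simp)
    have hsub' : (E' : Set (Sym2 V)) ⊆ E := fun x hx => hsub (by simpa using Or.inr hx)
    obtain ⟨h1, h2⟩ := ih hsub'
    have hce : c e ∉ s ∪ {y | ∃ e ∈ E', y = c e} := by
      rintro (h | ⟨e', he', h⟩)
      · exact hc e heE h
      · have := hci e heE e' (hsub' he') h
        exact he (this ▸ he')
    have hdiag := hd e heE
    have hes := hs e heE
    have hnew : e ∉ {f | ∃ e ∈ E', ∃ u ∈ e, f = s(u, c e)} := by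
      rintro ⟨e', he', u, hu, rfl⟩
      exact hc e' (hsub' he') (hes _ (by simp))
    clear ih
    induction e using Sym2.ind with
    | _ a b =>
    have hab : a ≠ b := by simpa using hdiag
    have k1 := subOn_step h1 h2 hce hab (Or.inl ⟨heE, by simpa using he⟩)
    have e1 : insert (c s(a, b)) (s ∪ {y | ∃ e ∈ E', y = c e}) = s ∪ {y | ∃ e ∈ insert s(a, b) E', y = c e} := by
      ext y
      simp only [Set.mem_insert_iff, Set.mem_union, Set.mem_ofPred_eq, Finset.mem_insert, exists_eq_or_imp]
      tauto
    have e2 : (((E \ E') ∪ {f | ∃ e ∈ E', ∃ u ∈ e, f = s(u, c e)}) \ {s(a, b)}) ∪ {s(a, c s(a, b)), s(c s(a, b), b)} =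
        (E \ (insert s(a, b) E' : Finset (Sym2 V))) ∪ {f | ∃ e ∈ insert s(a, b) E', ∃ u ∈ e, f = s(u, c e)} := by
      ext f
      simp only [Set.mem_insert_iff, Set.mem_union, Set.mem_ofPred_eq, Finset.mem_insert, exists_eq_or_imp, Set.mem_sdiff,
        Set.mem_singleton_iff, Finset.mem_coe, Sym2.mem_iff, exists_eq_left]
      rw [Sym2.eq_swap (a := c s(a, b)) (b := b)]
      constructor
      · rintro (⟨h | h, h'⟩ | h)
        · left; tauto
        · right; right; exact h
        · right; left; exact h
      · rintro (h | h | h)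
        · left; tauto
        · right; exact h
        · left
          refine ⟨Or.inr h, ?_⟩
          rintro rfl
          exact hnew h
    rw [e1, e2] at k1
    refine ⟨k1, ?_⟩
    intro f hf v hv
    rcases hf with ⟨hf, -⟩ | ⟨e', he', u, hu, rfl⟩
    · exact Or.inl (hs f hf v hv)
    · rcases Sym2.mem_iff.mp hv with rfl | rfl
      · left
        exact hs e' (hsub he') _ hu
      · right
        exact ⟨e', he', rfl⟩

lemma copy_of_emb {V U : Type} (G : SimpleGraph V) (S : SimpleGraph U) (f : S ↪g G) : HasInducedCopy G S := by
  refine ⟨Set.range f, ⟨SimpleGraph.Iso.symm ⟨Equiv.ofInjective f f.injective, ?_⟩⟩⟩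
  intro u v
  simp only [SimpleGraph.comap_adj, Function.Embedding.subtype_apply, Equiv.ofInjective_apply]
  exact f.map_adj_iff

lemma sub_of_bic (G : SimpleGraph V) (r t : ℕ) (h : HasBic G r t) :
    HasInducedSubdivision G (completeBipartiteGraph (Fin r) (Fin t)) := by
  obtain ⟨Q, C, hQ, hC, hQi, hCi, hadj⟩ := h
  refine ⟨_, _, IsSubdivision.refl _, copy_of_emb _ _ ?_⟩
  let eQ := Q.equivFinOfCardEq hQ
  let eC := C.equivFinOfCardEq hC
  let f : Fin r ⊕ Fin t → V := Sum.elim (fun i => (eQ.symm i).1) (fun j => (eC.symm j).1)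
  have hf : Function.Injective f := by
    rintro (i | i) (j | j) h
    · have := eQ.symm.injective (Subtype.ext h)
      rw [this]
    · exfalso
      have h1 := hadj _ (eQ.symm i).2 _ (eC.symm j).2
      exact h1.ne h
    · exfalso
      have h1 := hadj _ (eQ.symm j).2 _ (eC.symm i).2
      exact h1.ne h.symm
    · have := eC.symm.injective (Subtype.ext h)
      rw [this]
  refine ⟨⟨f, hf⟩, ?_⟩
  rintro (i | i) (j | j)
  · simpa [f] using hQi _ (eQ.symm i).2 _ (eQ.symm j).2
  · simpa [f] using hadj _ (eQ.symm i).2 _ (eC.symm j).2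
  · simpa [f] using (hadj _ (eQ.symm j).2 _ (eC.symm i).2).symm
  · simpa [f] using hCi _ (eC.symm i).2 _ (eC.symm j).2

lemma sub_of_induce {V W : Type} (G : SimpleGraph V) (s : Set V) (H : SimpleGraph W) (h : HasInducedSubdivision (G.induce s) H) :
    HasInducedSubdivision G H := by
  obtain ⟨U, S, hS, t, ⟨f⟩⟩ := h
  refine ⟨U, S, hS, copy_of_emb _ _ ?_⟩
  exact (SimpleGraph.Embedding.induce s).comp ((SimpleGraph.Embedding.induce t).comp f.symm.toEmbedding)

lemma finish {W : Type} [Fintype W] [Nonempty W] (H : SimpleGraph W) (L : Finset (W × W))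
    (hL : ∀ u v, H.Adj u v ↔ (u, v) ∈ L ∨ (v, u) ∈ L) (hanti : ∀ u v, (u, v) ∈ L → (v, u) ∉ L)
    (G : SimpleGraph V) (z : ℕ) (hz : Fintype.card W * 2 ^ L.card ≤ z) (B I : Finset V) (p q : V → V)
    (hB : Indep G B) (hI : Indep G I)
    (hpq : ∀ a ∈ I, p a ∈ B ∧ q a ∈ B ∧ p a ≠ q a ∧ nb G a ∩ B = {p a, q a})
    (hinj : ∀ a ∈ I, ∀ a' ∈ I, p a = p a' → q a = q a' → a = a') (hc : z * B.card < I.card) :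
    HasInducedSubdivision G H := by
  let F : SimpleGraph V := SimpleGraph.fromEdgeSet {e | ∃ a ∈ I, s(p a, q a) = e}
  have hIne : I.Nonempty := Finset.card_pos.mp (by omega)
  have hBne : B.Nonempty := by
    obtain ⟨a, ha⟩ := hIne
    exact ⟨_, (hpq a ha).1⟩
  have hdisj : ∀ a ∈ I, a ∉ B := by
    intro a ha haB
    have h1 : p a ∈ nb G a ∩ B := by rw [(hpq a ha).2.2.2]; simp
    exact hB a haB _ (hpq a ha).1 (mem_nb.mp (Finset.mem_inter.mp h1).1)
  have hE2 : I.card ≤ E2 F B := by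
    unfold E2
    rw [← Finset.card_sigma]
    apply Finset.card_le_card_of_injOn (fun a => (⟨p a, q a⟩ : Σ _ : V, V))
    · intro a ha
      have ha' : a ∈ I := ha
      obtain ⟨h1, h2, h3, -⟩ := hpq a ha'
      simp only [Finset.mem_coe, Finset.mem_sigma, Finset.mem_inter, mem_nb]
      refine ⟨h1, ?_, h2⟩
      simp only [F, SimpleGraph.fromEdgeSet_adj]
      exact ⟨⟨a, ha', rfl⟩, h3⟩
    · intro a ha a' ha' h
      simp only [Sigma.mk.injEq, heq_eq_eq] at h
      exact hinj a ha a' ha' h.1 h.2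
  obtain ⟨φ, P, m1, m2, m3, m4⟩ := mader F L B hBne (by
    calc _ ≤ z * B.card := Nat.mul_le_mul_right _ hz
      _ ≤ _ := by omega)
  obtain ⟨s, E, hsub, hsupp, hEF, hsB⟩ := subOn_all H F L hL hanti B φ P m1 m2 m3 m4
  have hEF' : ∀ e ∈ E, (∃ a ∈ I, s(p a, q a) = e) ∧ ¬ e.IsDiag := by
    intro e he
    have := hEF he
    simp only [F, SimpleGraph.edgeSet_fromEdgeSet] at this
    exact ⟨this.1, this.2⟩
  have hch : ∀ e, ∃ a, e ∈ E → a ∈ I ∧ s(p a, q a) = e := by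
    intro e
    by_cases he : e ∈ E
    · obtain ⟨⟨a, ha, h⟩, -⟩ := hEF' e he
      exact ⟨a, fun _ => ⟨ha, h⟩⟩
    · exact ⟨hBne.choose, fun h => absurd h he⟩
  choose c hcI using hch
  have hEfin : E.Finite := Set.toFinite E
  obtain ⟨k1, -⟩ := subOn_once H s E hsub hsupp (fun e he => (hEF' e he).2) c
    (fun e he hs => hdisj _ (hcI e he).1 (hsB _ hs))
    (fun e he e' he' h => by rw [← (hcI e he).2, ← (hcI e' he').2, h]) hEfin.toFinset (by simp)
  obtain ⟨U, S, hS, ⟨f⟩⟩ := k1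
  refine ⟨U, S, hS, s ∪ {y | ∃ e ∈ hEfin.toFinset, y = c e}, ⟨RelIso.trans ?_ f⟩⟩
  refine ⟨Equiv.refl _, ?_⟩
  have hmem : ∀ e ∈ E, ∀ v ∈ s, G.Adj (c e) v ↔ v ∈ e := by
    intro e he v hv
    obtain ⟨h1, h2⟩ := hcI e he
    have h3 := (hpq _ h1).2.2.2
    have h4 : v ∈ nb G (c e) ∩ B ↔ v = p (c e) ∨ v = q (c e) := by rw [h3]; simp
    rw [Finset.mem_inter, mem_nb] at h4
    rw [← Sym2.mem_iff, h2] at h4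
    have := hsB v hv
    tauto
  have hcs : ∀ e ∈ E, c e ∉ s := fun e he hs => hdisj _ (hcI e he).1 (hsB _ hs)
  have hmem2 : ∀ e ∈ E, ∀ v ∈ s, (∃ e' ∈ E, ∃ u ∈ e', s(c e, v) = s(u, c e')) ↔ v ∈ e := by
    intro e he v hv
    constructor
    · rintro ⟨e', he', u, hu, h⟩
      rw [Sym2.eq_iff] at h
      rcases h with ⟨h1, h2⟩ | ⟨h1, h2⟩
      · exact absurd (h2 ▸ hv) (hcs e' he')
      · have : e = e' := by rw [← (hcI e he).2, ← (hcI e' he').2, h1]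
        rw [this, h2]; exact hu
    · intro h
      exact ⟨e, he, v, h, Sym2.eq_swap⟩
  rintro ⟨u, hu⟩ ⟨v, hv⟩
  simp only [SimpleGraph.comap_adj, Function.Embedding.subtype_apply, SimpleGraph.fromEdgeSet_adj, Equiv.refl_apply,
    Set.Finite.coe_toFinset, Set.sdiff_self, Set.mem_union, Set.mem_empty_iff_false, false_or, Set.mem_ofPred_eq,
    Set.Finite.mem_toFinset] at hu hv ⊢
  rcases hu with hu | ⟨e, he, rfl⟩
  · rcases hv with hv | ⟨e', he', rfl⟩
    · constructor
      · rintro ⟨⟨e, he, w, hw, h⟩, -⟩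
        rw [Sym2.eq_iff] at h
        rcases h with ⟨h1, h2⟩ | ⟨h1, h2⟩
        · exact absurd (h2 ▸ hv) (hcs e he)
        · exact absurd (h1 ▸ hu) (hcs e he)
      · intro h
        exact absurd h (hB u (hsB u hu) v (hsB v hv))
    · rw [G.adj_comm, hmem e' he' u hu, ← hmem2 e' he' u hu, Sym2.eq_swap]
      constructor
      · exact fun h => h.1
      · exact fun h => ⟨h, fun h' => hcs e' he' (h' ▸ hu)⟩
  · rcases hv with hv | ⟨e', he', rfl⟩
    · rw [hmem e he v hv, ← hmem2 e he v hv]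
      constructor
      · exact fun h => h.1
      · exact fun h => ⟨h, fun h' => hcs e he (h'.symm ▸ hv)⟩
    · constructor
      · rintro ⟨⟨e1, he1, w, hw, h⟩, -⟩
        have hws := hsupp e1 he1 w hw
        rw [Sym2.eq_iff] at h
        rcases h with ⟨h1, h2⟩ | ⟨h1, h2⟩
        · exact absurd (h1 ▸ hws) (hcs e he)
        · exact absurd (h2 ▸ hws) (hcs e' he')
      · intro h
        exact absurd h (hI _ (hcI e he).1 _ (hcI e' he').1)

lemma core (G : SimpleGraph V) (r t w z R d₁ : ℕ) (hr : 0 < r) (hR : R = (w + (r + t)) ^ (r + t) + r)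
    (hz : z = (r + t) * 2 ^ (r * t) + 200 + 2 * r + R)
    (hcl : ∀ Q : Finset V, G.IsClique (Q : Set V) → Q.card ≤ w)
    (hV : 0 < Fintype.card V) (hd1 : z ^ 14 * z ^ (17 * r + 1) ≤ d₁)
    (hE1 : ∀ S : Finset V, E2 G S ≤ (d₁ + 1) * S.card) (hE2 : d₁ * Fintype.card V ≤ E2 G Finset.univ) :
    HasInducedSubdivision G (completeBipartiteGraph (Fin r) (Fin t)) := by
  by_contra hno
  have hbic : ¬ HasBic G r t := fun h => hno (sub_of_bic G r t h)
  have hzpos : 0 < z := by omega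
  have hz14 : 0 < z ^ 14 := by positivity
  set x := d₁ / z ^ 14 with hx
  have hxX : z ^ (17 * r + 1) ≤ x := by
    rw [hx, Nat.le_div_iff_mul_le hz14, mul_comm]; exact hd1
  have hzx : z ≤ x := (Nat.le_self_pow (by omega) z).trans hxX
  have hdd : z ^ 14 * x ≤ d₁ := Nat.mul_div_le d₁ (z ^ 14)
  have hdd2 : d₁ < z ^ 14 * x + z ^ 14 := by
    have := Nat.lt_mul_div_succ d₁ hz14
    rw [← hx] at this
    nlinarith
  have hxx : z ^ 14 ≤ z ^ 14 * x := Nat.le_mul_of_pos_right _ (by omega)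
  have hram : ∀ T : Finset V, R ≤ T.card → ∃ I ⊆ T, I.card = r + t ∧ Indep G I := by
    intro T hT
    apply ramsey G (r + t) w T (fun Q _ hQ => hcl Q hQ)
    have := Nat.choose_le_pow (w + (r + t)) (r + t)
    omega
  have hsubI : ∀ k ≤ r + t, ∀ T : Finset V, R ≤ T.card → ∃ I ⊆ T, I.card = k ∧ Indep G I := by
    intro k hk T hT
    obtain ⟨I, h1, h2, h3⟩ := hram T hT
    obtain ⟨J, hJ, hJc⟩ := Finset.exists_subset_card_eq (s := I) (n := k) (by omega)
    exact ⟨J, hJ.trans h1, hJc, fun a ha b hb => h3 a (hJ ha) b (hJ hb)⟩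
  have hD : ∀ S Y : Finset V, S.card ≤ z * (z ^ 14 * x) → (∀ b ∈ Y, x ≤ (nb G b ∩ S).card) → Y.card ≤ x := by
    intro S Y hS hY
    have h1 := few_dense G R r t (by omega) (hsubI r (by omega)) (hsubI t (by omega)) hbic S Y x (by omega) hY
    have h2 : x ≤ 2 * (x + 1 - r) := by omega
    have hxr : 0 < x ^ r := Nat.pow_pos (by omega)
    have h3 : Y.card * x ^ r ≤ z ^ (17 * r + 1) * x ^ r := by
      calc Y.card * x ^ r ≤ Y.card * (2 * (x + 1 - r)) ^ r := by gcongr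
        _ = 2 ^ r * (Y.card * (x + 1 - r) ^ r) := by rw [mul_pow]; ring
        _ ≤ 2 ^ r * (R ^ (r + 1) * S.card ^ r) := Nat.mul_le_mul_left _ h1
        _ ≤ z ^ r * (z ^ (r + 1) * (z * (z ^ 14 * x)) ^ r) := by
          have : R ≤ z := by omega
          have : 2 ≤ z := by omega
          gcongr
        _ = z ^ (17 * r + 1) * x ^ r := by
          rw [mul_pow, mul_pow, ← pow_mul]; ring
    exact (Nat.le_of_mul_le_mul_right h3 hxr).trans hxX
  obtain ⟨B, I, p, q, s1, s2, s3, s4, s5⟩ := structure_lem G z x (z ^ 14 * x) (by omega) (by omega) rfl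
    (fun S => (hE1 S).trans (Nat.mul_le_mul_right _ (by omega))) (le_trans (Nat.mul_le_mul_right _ hdd) hE2) hV hD
  apply hno
  haveI : Nonempty (Fin r ⊕ Fin t) := ⟨Sum.inl ⟨0, hr⟩⟩
  let L : Finset ((Fin r ⊕ Fin t) × (Fin r ⊕ Fin t)) := (Finset.univ : Finset (Fin r × Fin t)).image (fun e => (Sum.inl e.1, Sum.inr e.2))
  have hLc : L.card ≤ r * t := by
    refine Finset.card_image_le.trans ?_
    simp
  refine finish (completeBipartiteGraph (Fin r) (Fin t)) L ?_ ?_ G z ?_ B I p q s1 s2 s3 s4 s5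
  · rintro (u | u) (v | v) <;> simp [L]
  · rintro (u | u) (v | v) <;> simp [L]
  · have : Fintype.card (Fin r ⊕ Fin t) = r + t := by simp
    rw [this]
    calc (r + t) * 2 ^ L.card ≤ (r + t) * 2 ^ (r * t) := by gcongr; norm_num
      _ ≤ z := by omega

lemma E2_induce (G : SimpleGraph V) (S : Finset V) (T : Finset (S : Set V)) :
    E2 (G.induce (S : Set V)) T = E2 G (T.map (Function.Embedding.subtype _)) := by
  unfold E2
  rw [Finset.sum_map]
  apply Finset.sum_congr rfl
  intro x hx
  rw [← Finset.card_map (Function.Embedding.subtype _)]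
  congr 1
  ext y
  simp only [Finset.mem_map, Finset.mem_inter, mem_nb, Function.Embedding.subtype_apply, SimpleGraph.comap_adj]
  constructor
  · rintro ⟨a, ⟨h1, h2⟩, rfl⟩
    exact ⟨h1, a, h2, rfl⟩
  · rintro ⟨h1, a, h2, rfl⟩
    exact ⟨a, ⟨h1, h2⟩, rfl⟩

lemma E2_le (G : SimpleGraph V) (S : Finset V) : E2 G S ≤ Fintype.card V * S.card := by
  calc E2 G S ≤ ∑ x ∈ S, Fintype.card V := Finset.sum_le_sum (fun x _ => Finset.card_le_univ _)
    _ = _ := by simp [mul_comm]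

lemma bound (G : SimpleGraph V) (r t w z R : ℕ) (hr : 0 < r) (hR : R = (w + (r + t)) ^ (r + t) + r)
    (hz : z = (r + t) * 2 ^ (r * t) + 200 + 2 * r + R)
    (hcl : ∀ Q : Finset V, G.IsClique (Q : Set V) → Q.card ≤ w)
    (hV : 0 < Fintype.card V) (hE : z ^ 14 * z ^ (17 * r + 1) * Fintype.card V ≤ E2 G Finset.univ) :
    HasInducedSubdivision G (completeBipartiteGraph (Fin r) (Fin t)) := by
  let P : ℕ → Prop := fun d => ∃ S : Finset V, S.Nonempty ∧ d * S.card ≤ E2 G S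
  have hPle : ∀ d, P d → d ≤ Fintype.card V := by
    rintro d ⟨S, hS, h⟩
    exact Nat.le_of_mul_le_mul_right (h.trans (E2_le G S)) (Finset.card_pos.mpr hS)
  have hP0 : P (z ^ 14 * z ^ (17 * r + 1)) := ⟨Finset.univ, by
    rw [← Finset.card_pos, Finset.card_univ]; exact hV, hE⟩
  have hd1 := Nat.le_findGreatest (P := P) (hPle _ hP0) hP0
  have hPd := Nat.findGreatest_spec (P := P) (hPle _ hP0) hP0
  set d₁ := Nat.findGreatest P (Fintype.card V) with hd₁
  have hnP : ¬ P (d₁ + 1) := by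
    intro h
    exact Nat.findGreatest_is_greatest (P := P) (Nat.lt_succ_self _) (hPle _ h) h
  obtain ⟨S, hS, hSE⟩ := hPd
  have hcard : Fintype.card (S : Set V) = S.card := by simp
  apply sub_of_induce G (S : Set V)
  refine core (G.induce (S : Set V)) r t w z R d₁ hr hR hz ?_ ?_ hd1 ?_ ?_
  · intro Q hQ
    rw [← Finset.card_map (Function.Embedding.subtype _)]
    apply hcl
    intro a ha b hb hab
    simp only [Finset.coe_map, Set.mem_image, Function.Embedding.subtype_apply] at ha hb
    obtain ⟨a', ha', rfl⟩ := ha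
    obtain ⟨b', hb', rfl⟩ := hb
    exact hQ ha' hb' (fun h => hab (by rw [h]))
  · rw [hcard]; exact Finset.card_pos.mpr hS
  · intro T
    rw [E2_induce, ← Finset.card_map (Function.Embedding.subtype _)]
    set T' := T.map (Function.Embedding.subtype _)
    rcases T'.eq_empty_or_nonempty with h | h
    · rw [h]; simp [E2]
    · by_contra hcon
      exact hnP ⟨T', h, by omega⟩
  · rw [E2_induce, hcard]
    have : (Finset.univ : Finset (S : Set V)).map (Function.Embedding.subtype _) = S := by
      ext y; simp
    rw [this]
    exact hSE

lemma avgDeg_eq (G : SimpleGraph V) : avgDeg G = (E2 G Finset.univ : ℝ) / Fintype.card V := by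
  have h1 : E2 G Finset.univ = 2 * G.edgeSet.ncard := by
    have h2 := G.sum_degrees_eq_twice_card_edges
    rw [E2_univ, Set.ncard_eq_toFinset_card', ← SimpleGraph.edgeFinset, ← h2]
    apply Finset.sum_congr rfl
    intro v _
    rw [← SimpleGraph.card_neighborFinset_eq_degree]
    congr 1
    ext u
    simp [mem_nb]
  rw [avgDeg, h1]
  push_cast
  rfl

end Main
end Sub17

/-- For all positive integers `r, t` there is a polynomial `g` such that
every graph `G` with no induced subdivision of `K_{r,t}` has average degree at most
`g(ω(G))`. -/
theorem stmt_17 (r t : ℕ) (hr : 0 < r) (ht : 0 < t) :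
    ∃ g : Polynomial ℝ, ∀ (V : Type) [Fintype V], ∀ G : SimpleGraph V,
      ¬ HasInducedSubdivision G (completeBipartiteGraph (Fin r) (Fin t)) →
        avgDeg G ≤ g.eval (G.cliqueNum : ℝ) := by
  let Z : Polynomial ℝ := Polynomial.C (((r + t) * 2 ^ (r * t) + 200 + 2 * r + r : ℕ) : ℝ) +
    (Polynomial.X + Polynomial.C ((r + t : ℕ) : ℝ)) ^ (r + t)
  refine ⟨Z ^ 14 * Z ^ (17 * r + 1), ?_⟩
  intro V _ G hno
  set w := G.cliqueNum with hw
  let z : ℕ := (r + t) * 2 ^ (r * t) + 200 + 2 * r + ((w + (r + t)) ^ (r + t) + r)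
  have hZ : Z.eval (w : ℝ) = (z : ℝ) := by
    simp only [Z, z, Polynomial.eval_add, Polynomial.eval_pow, Polynomial.eval_X, Polynomial.eval_C]
    push_cast
    ring
  have hev : (Z ^ 14 * Z ^ (17 * r + 1)).eval (w : ℝ) = ((z ^ 14 * z ^ (17 * r + 1) : ℕ) : ℝ) := by
    rw [Polynomial.eval_mul, Polynomial.eval_pow, Polynomial.eval_pow, hZ]
    push_cast
    rfl
  rw [hev, Sub17.avgDeg_eq]
  rcases Nat.eq_zero_or_pos (Fintype.card V) with h0 | hpos
  · rw [h0]
    simp only [Nat.cast_zero, div_zero]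
    positivity
  · have hpos' : (0 : ℝ) < Fintype.card V := by exact_mod_cast hpos
    rw [div_le_iff₀ hpos']
    by_contra hcon
    push Not at hcon
    apply hno
    refine Sub17.bound G r t w z _ hr rfl rfl ?_ hpos (by exact_mod_cast hcon.le)
    intro Q hQ
    exact SimpleGraph.IsClique.card_le_cliqueNum (tc := hQ)
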